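/- (Convergence of the numerical solution up to a subsequence) Assume (A0) and (A1) and let T > 0. Let (ε_k) = (Δt_k, Δx_k) be a sequence of mesh parameters tending to zero, each satisfying the CFL condition (CFL′), and let (U^{α,n}_i)_{ε_k} denote the corresponding numerical solutions of the scheme (NS) with initial condition U^{α,0}_i = u₀^α(iΔx_k). Then there exist a subsequence of (ε_k) and a viscosity solution u = (u^α) of (HJ)-(CI) on [0,T)×J such that along this subsequence, for every compact set K ⊂ [0,T)×J, sup{|u^α(nΔt, iΔx) − U^{α,n}_i| : (nΔt, iΔx e_α) ∈ K} → 0. -/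

import Mathlib

open Set Filter

/-- Assumption (A1) for a single Hamiltonian: `H` is `C¹`, coercive
(`H p → +∞` as `|p| → +∞`), non-increasing on `(-∞, p₀]` and non-decreasing on `[p₀, +∞)`. -/
def A1cond (H : ℝ → ℝ) (p₀ : ℝ) : Prop :=
  ContDiff ℝ 1 H ∧ Tendsto H (cocompact ℝ) atTop ∧
    AntitoneOn H (Iic p₀) ∧ MonotoneOn H (Ici p₀)

/-- The non-increasing envelope `H⁻` of `H` with turning point `p₀`. -/
noncomputable def Hm (H : ℝ → ℝ) (p₀ : ℝ) (p : ℝ) : ℝ :=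
  if p ≤ p₀ then H p else H p₀

/-- The non-decreasing envelope `H⁺` of `H` with turning point `p₀`. -/
noncomputable def Hp (H : ℝ → ℝ) (p₀ : ℝ) (p : ℝ) : ℝ :=
  if p ≤ p₀ then H p₀ else H p

/-- One time step of the numerical scheme (NS) on the junction:
`V` (the values at time `n+1`) is computed from `U` (the values at time `n`).
For `i ≥ 1` on each branch `α` the update uses
`max (H⁺_α(p_{i,-}), H⁻_α(p_{i,+}))`; at the junction point `i = 0` all branches share a
common value and the update uses `max_β H⁻_β(p^β_{0,+})`. -/
def SchemeStep {N : ℕ} (H : Fin N → ℝ → ℝ) (p₀ : Fin N → ℝ) (Δx Δt : ℝ)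
    (U V : Fin N → ℕ → ℝ) : Prop :=
  (∀ (α : Fin N) (i : ℕ), 1 ≤ i →
      V α i = U α i - Δt * max (Hp (H α) (p₀ α) ((U α i - U α (i - 1)) / Δx))
        (Hm (H α) (p₀ α) ((U α (i + 1) - U α i) / Δx))) ∧
  (∀ α β : Fin N, U α 0 = U β 0) ∧
  (∀ α : Fin N, V α 0 = U α 0 - Δt *
      sSup (Set.range fun β : Fin N => Hm (H β) (p₀ β) ((U β 1 - U β 0) / Δx)))

/-- The numerical scheme (NS): `U α n i` is the value on branch `α` at time step `n`
and grid point `i`. -/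
def SchemeNS {N : ℕ} (H : Fin N → ℝ → ℝ) (p₀ : Fin N → ℝ) (Δx Δt : ℝ)
    (U : Fin N → ℕ → ℕ → ℝ) : Prop :=
  ∀ n : ℕ, SchemeStep H p₀ Δx Δt (fun α i => U α n i) (fun α i => U α (n + 1) i)

/-- Viscosity subsolution of the Hamilton–Jacobi equation (HJ) on the junction, on
`J_T = (0,T) × J`. The junction is encoded by the family of branch restrictions
`u α t x` (`x ≥ 0`), sharing a common value at the junction point `x = 0`. -/
def IsViscSubSol {N : ℕ} (T : ℝ) (H : Fin N → ℝ → ℝ) (p₀ : Fin N → ℝ)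
    (u : Fin N → ℝ → ℝ → ℝ) : Prop :=
  (∀ α, UpperSemicontinuousOn (fun q : ℝ × ℝ => u α q.1 q.2) (Ico 0 T ×ˢ Ici 0)) ∧
  (∀ (α β : Fin N) (t : ℝ), u α t 0 = u β t 0) ∧
  (∀ φ : Fin N → ℝ → ℝ → ℝ,
    (∀ α, ContDiffOn ℝ 1 (fun q : ℝ × ℝ => φ α q.1 q.2) (Ioo 0 T ×ˢ Ici 0)) →
    (∀ (α β : Fin N) (t : ℝ), φ α t 0 = φ β t 0) →
    (∀ (β : Fin N) (t x : ℝ), t ∈ Ioo 0 T → 0 ≤ x → u β t x ≤ φ β t x) →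
    ((∀ (α : Fin N) (t x : ℝ), t ∈ Ioo 0 T → 0 < x → u α t x = φ α t x →
        deriv (fun s => φ α s x) t
          + H α (derivWithin (fun y => φ α t y) (Ici 0) x) ≤ 0) ∧
     (∀ t : ℝ, t ∈ Ioo 0 T → (∀ α : Fin N, u α t 0 = φ α t 0) → ∀ α : Fin N,
        deriv (fun s => φ α s 0) t
          + sSup (Set.range fun β : Fin N =>
              Hm (H β) (p₀ β) (derivWithin (fun y => φ β t y) (Ici 0) 0)) ≤ 0)))

/-- Viscosity supersolution of (HJ) on the junction, on `J_T = (0,T) × J`. -/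
def IsViscSuperSol {N : ℕ} (T : ℝ) (H : Fin N → ℝ → ℝ) (p₀ : Fin N → ℝ)
    (u : Fin N → ℝ → ℝ → ℝ) : Prop :=
  (∀ α, LowerSemicontinuousOn (fun q : ℝ × ℝ => u α q.1 q.2) (Ico 0 T ×ˢ Ici 0)) ∧
  (∀ (α β : Fin N) (t : ℝ), u α t 0 = u β t 0) ∧
  (∀ φ : Fin N → ℝ → ℝ → ℝ,
    (∀ α, ContDiffOn ℝ 1 (fun q : ℝ × ℝ => φ α q.1 q.2) (Ioo 0 T ×ˢ Ici 0)) →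
    (∀ (α β : Fin N) (t : ℝ), φ α t 0 = φ β t 0) →
    (∀ (β : Fin N) (t x : ℝ), t ∈ Ioo 0 T → 0 ≤ x → φ β t x ≤ u β t x) →
    ((∀ (α : Fin N) (t x : ℝ), t ∈ Ioo 0 T → 0 < x → u α t x = φ α t x →
        0 ≤ deriv (fun s => φ α s x) t
          + H α (derivWithin (fun y => φ α t y) (Ici 0) x)) ∧
     (∀ t : ℝ, t ∈ Ioo 0 T → (∀ α : Fin N, u α t 0 = φ α t 0) → ∀ α : Fin N,
        0 ≤ deriv (fun s => φ α s 0) t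
          + sSup (Set.range fun β : Fin N =>
              Hm (H β) (p₀ β) (derivWithin (fun y => φ β t y) (Ici 0) 0)))))

/-- Viscosity subsolution of (HJ)-(CI): subsolution of (HJ) on `J_T` with
`u(0,·) ≤ u₀` on `J`. -/
def IsViscSubSolCI {N : ℕ} (T : ℝ) (H : Fin N → ℝ → ℝ) (p₀ : Fin N → ℝ)
    (u₀ : Fin N → ℝ → ℝ) (u : Fin N → ℝ → ℝ → ℝ) : Prop :=
  IsViscSubSol T H p₀ u ∧ ∀ (α : Fin N) (x : ℝ), 0 ≤ x → u α 0 x ≤ u₀ α x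

/-- Viscosity supersolution of (HJ)-(CI): supersolution of (HJ) on `J_T` with
`u(0,·) ≥ u₀` on `J`. -/
def IsViscSuperSolCI {N : ℕ} (T : ℝ) (H : Fin N → ℝ → ℝ) (p₀ : Fin N → ℝ)
    (u₀ : Fin N → ℝ → ℝ) (u : Fin N → ℝ → ℝ → ℝ) : Prop :=
  IsViscSuperSol T H p₀ u ∧ ∀ (α : Fin N) (x : ℝ), 0 ≤ x → u₀ α x ≤ u α 0 x

/-- Viscosity solution of (HJ)-(CI) on `[0,T) × J`. -/
def IsViscSolCI {N : ℕ} (T : ℝ) (H : Fin N → ℝ → ℝ) (p₀ : Fin N → ℝ)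
    (u₀ : Fin N → ℝ → ℝ) (u : Fin N → ℝ → ℝ → ℝ) : Prop :=
  IsViscSubSolCI T H p₀ u₀ u ∧ IsViscSuperSolCI T H p₀ u₀ u

/-- Assumption (A0): Lipschitz initial data on each branch, with a common value at the
junction point. -/
def A0cond {N : ℕ} (u₀ : Fin N → ℝ → ℝ) : Prop :=
  (∀ α, ∃ C : NNReal, LipschitzOnWith C (u₀ α) (Ici 0)) ∧
  (∀ α β : Fin N, u₀ α 0 = u₀ β 0)

/-- Assumption (A1′): each `H_α` is the Legendre–Fenchel transform of a uniformly convex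
`C²` Lagrangian `L_α`, and `H⁻_α`, `H⁺_α` are the corresponding one-sided transforms. -/
def A1primeCond {N : ℕ} (H : Fin N → ℝ → ℝ) (p₀ : Fin N → ℝ) : Prop :=
  ∃ (γ : ℝ) (L : Fin N → ℝ → ℝ), 0 < γ ∧
    (∀ α, ContDiff ℝ 2 (L α)) ∧
    (∀ (α : Fin N) (q : ℝ), γ ≤ deriv (deriv (L α)) q) ∧
    (∀ (α : Fin N) (p : ℝ), H α p = sSup (Set.range fun q : ℝ => p * q - L α q)) ∧
    (∀ (α : Fin N) (p : ℝ),
      Hm (H α) (p₀ α) p = sSup ((fun q : ℝ => p * q - L α q) '' Iic 0)) ∧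
    (∀ (α : Fin N) (p : ℝ),
      Hp (H α) (p₀ α) p = sSup ((fun q : ℝ => p * q - L α q) '' Ici 0))

/-- The CFL condition (CFL′) for the scheme (NS): `Δx/Δt` dominates `|H'_α|` on
`[p̲_α, p̄_α]`, where `p̲_α, p̄_α` are determined by the level `-m⁰`,
`m⁰ = inf_{β,i} W^{β,0}_i`. -/
def CFLprime {N : ℕ} (H : Fin N → ℝ → ℝ) (p₀ : Fin N → ℝ) (Δx Δt : ℝ)
    (U : Fin N → ℕ → ℕ → ℝ) : Prop :=
  ∀ α : Fin N, ∀ p ∈ Icc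
      (sInf {p : ℝ | Hm (H α) (p₀ α) p =
        -(sInf (Set.range fun q : Fin N × ℕ => (U q.1 1 q.2 - U q.1 0 q.2) / Δt))})
      (sSup {p : ℝ | Hp (H α) (p₀ α) p =
        -(sInf (Set.range fun q : Fin N × ℕ => (U q.1 1 q.2 - U q.1 0 q.2) / Δt))}),
    |deriv (H α) p| ≤ Δx / Δt

section Envelopes

variable {H : ℝ → ℝ} {p₀ : ℝ}

theorem Hm_eq_min (H : ℝ → ℝ) (p₀ p : ℝ) : Hm H p₀ p = H (min p p₀) := by
  unfold Hm
  split_ifs with h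
  · rw [min_eq_left h]
  · rw [min_eq_right (not_le.1 h).le]

theorem Hp_eq_Hm_reflect (H : ℝ → ℝ) (p₀ p : ℝ) :
    Hp H p₀ p = Hm (fun q => H (-q)) (-p₀) (-p) := by
  rw [Hm_eq_min]
  unfold Hp
  split_ifs with h
  · simp [min_eq_right (neg_le_neg h)]
  · simp [min_eq_left (neg_le_neg (not_le.1 h).le)]

theorem A1cond.reflect (h : A1cond H p₀) : A1cond (fun q => H (-q)) (-p₀) := by
  obtain ⟨h1, h2, h3, h4⟩ := h
  refine ⟨h1.comp contDiff_neg, h2.comp (Homeomorph.neg ℝ).isClosedEmbedding.tendsto_cocompact,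
    ?_, ?_⟩
  · intro x hx y hy hxy
    rw [mem_Iic] at hx hy
    exact h4 (mem_Ici.2 (by linarith)) (mem_Ici.2 (by linarith)) (neg_le_neg hxy)
  · intro x hx y hy hxy
    rw [mem_Ici] at hx hy
    exact h3 (mem_Iic.2 (by linarith)) (mem_Iic.2 (by linarith)) (neg_le_neg hxy)

theorem A1cond.antitone_Hm (h : A1cond H p₀) : Antitone (Hm H p₀) := by
  intro p q hpq
  rw [Hm_eq_min, Hm_eq_min]
  exact h.2.2.1 (mem_Iic.2 (min_le_right _ _)) (mem_Iic.2 (min_le_right _ _))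
    (min_le_min_right _ hpq)

theorem A1cond.monotone_Hp (h : A1cond H p₀) : Monotone (Hp H p₀) := by
  intro p q hpq
  rw [Hp_eq_Hm_reflect, Hp_eq_Hm_reflect]
  exact h.reflect.antitone_Hm (neg_le_neg hpq)

theorem A1cond.continuous_Hm (h : A1cond H p₀) : Continuous (Hm H p₀) := by
  have : Hm H p₀ = fun p => H (min p p₀) := funext (Hm_eq_min H p₀)
  rw [this]
  exact h.1.continuous.comp (continuous_id.min continuous_const)

theorem A1cond.continuous_Hp (h : A1cond H p₀) : Continuous (Hp H p₀) := by
  have : Hp H p₀ = fun p => Hm (fun q => H (-q)) (-p₀) (-p) := funext (Hp_eq_Hm_reflect H p₀)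
  rw [this]
  exact h.reflect.continuous_Hm.comp continuous_neg

theorem A1cond.min_le_Hm (h : A1cond H p₀) (p : ℝ) : H p₀ ≤ Hm H p₀ p := by
  rw [Hm_eq_min]
  exact h.2.2.1 (mem_Iic.2 (min_le_right _ _)) (mem_Iic.2 le_rfl) (min_le_right _ _)

theorem A1cond.max_Hp_Hm (h : A1cond H p₀) (p : ℝ) : max (Hp H p₀ p) (Hm H p₀ p) = H p := by
  unfold Hp Hm
  split_ifs with hp
  · exact max_eq_right (h.2.2.1 hp (mem_Iic.2 le_rfl) hp)
  · exact max_eq_left (h.2.2.2 (mem_Ici.2 le_rfl) (not_le.1 hp).le (not_le.1 hp).le)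

/-- The infimum `a` of the level set `{H⁻ = l}` is attained and describes the sublevel set. -/
theorem A1cond.Hm_level (h : A1cond H p₀) {l : ℝ} (hl : H p₀ ≤ l) :
    H (sInf {p | Hm H p₀ p = l}) = l ∧ sInf {p | Hm H p₀ p = l} ≤ p₀ ∧
      ∀ p, Hm H p₀ p ≤ l ↔ sInf {p | Hm H p₀ p = l} ≤ p := by
  have hbig : ∀ᶠ p in atBot, l < H p :=
    (h.2.1.mono_left atBot_le_cocompact).eventually (eventually_gt_atTop l)
  obtain ⟨m, hm⟩ := (hbig.and (eventually_le_atBot p₀)).exists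
  obtain ⟨c, hc, hcl⟩ := intermediate_value_Icc' hm.2 h.1.continuous.continuousOn ⟨hl, hm.1.le⟩
  have hcS : c ∈ {p | Hm H p₀ p = l} := by
    simpa [Hm, hc.2] using hcl
  have hbdd : BddBelow {p | Hm H p₀ p = l} := by
    refine ⟨m, fun p hp => ?_⟩
    by_contra hpm
    have h1 := h.antitone_Hm (not_le.1 hpm).le
    have h2 : Hm H p₀ m = H m := by simp [Hm, hm.2]
    have hp : Hm H p₀ p = l := hp
    linarith [hm.1]
  have hclosed : IsClosed {p | Hm H p₀ p = l} := isClosed_eq h.continuous_Hm continuous_const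
  have hmem : Hm H p₀ (sInf {p | Hm H p₀ p = l}) = l := hclosed.csInf_mem ⟨c, hcS⟩ hbdd
  have hle : sInf {p | Hm H p₀ p = l} ≤ p₀ := (csInf_le hbdd hcS).trans hc.2
  refine ⟨?_, hle, fun p => ⟨fun hp => ?_, fun hp => ?_⟩⟩
  · rwa [Hm_eq_min, min_eq_left hle] at hmem
  · by_contra hlt
    have h1 := h.antitone_Hm (not_le.1 hlt).le
    rw [hmem] at h1
    exact hlt (csInf_le hbdd (le_antisymm hp h1))
  · have h1 := h.antitone_Hm hp
    rwa [hmem] at h1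

/-- Truncating `H⁻` at the level `H a` yields a function with the Lipschitz constant that `H`
has on `[a, p₀]`. -/
theorem A1cond.trunc_Hm_lipschitz (h : A1cond H p₀) {L a : ℝ} (ha : a ≤ p₀)
    (hL : ∀ p ∈ Icc a p₀, |deriv H p| ≤ L) {p q : ℝ} (hpq : p ≤ q) :
    min (Hm H p₀ p) (H a) - min (Hm H p₀ q) (H a) ≤ L * (q - p) := by
  have hL0 : 0 ≤ L := (abs_nonneg _).trans (hL p₀ ⟨ha, le_rfl⟩)
  have key : ∀ r, min (Hm H p₀ r) (H a) = H (min (max r a) p₀) := by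
    intro r
    have hHa : Hm H p₀ a = H a := by simp [Hm, ha]
    rw [← hHa, ← h.antitone_Hm.map_max, Hm_eq_min]
  rw [key, key]
  have hmem : ∀ r, min (max r a) p₀ ∈ Icc a p₀ := fun r =>
    ⟨le_min (le_max_right _ _) ha, min_le_right _ _⟩
  have hmv := (convex_Icc a p₀).norm_image_sub_le_of_norm_deriv_le
    (fun x _ => (h.1.differentiable one_ne_zero).differentiableAt) hL (hmem q) (hmem p)
  have hmono : min (max p a) p₀ ≤ min (max q a) p₀ :=
    min_le_min_right _ (max_le_max_right _ hpq)
  have hd : min (max q a) p₀ - min (max p a) p₀ ≤ q - p := by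
    rcases le_total p a with h1 | h1 <;> rcases le_total q a with h2 | h2 <;>
      rcases le_total (max p a) p₀ with h3 | h3 <;> rcases le_total (max q a) p₀ with h4 | h4 <;>
      simp only [h1, h2, max_eq_left, max_eq_right] at h3 h4 ⊢ <;>
      simp only [h3, h4, min_eq_left, min_eq_right] <;> linarith
  rw [Real.norm_eq_abs, Real.norm_eq_abs, abs_sub_comm (min (max p a) p₀),
    abs_of_nonneg (sub_nonneg.2 hmono)] at hmv
  exact (le_abs_self _).trans (hmv.trans (mul_le_mul_of_nonneg_left hd hL0))

theorem A1cond.Hp_level (h : A1cond H p₀) {l : ℝ} (hl : H p₀ ≤ l) :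
    H (sSup {p | Hp H p₀ p = l}) = l ∧ p₀ ≤ sSup {p | Hp H p₀ p = l} ∧
      ∀ p, Hp H p₀ p ≤ l ↔ p ≤ sSup {p | Hp H p₀ p = l} := by
  have hset : {p | Hm (fun q => H (-q)) (-p₀) p = l} = -{p | Hp H p₀ p = l} := by
    ext p
    simp [Hp_eq_Hm_reflect]
  have hS : sInf {p | Hm (fun q => H (-q)) (-p₀) p = l} = -sSup {p | Hp H p₀ p = l} := by
    rw [hset, Real.sInf_def, neg_neg]
  obtain ⟨h1, h2, h3⟩ := h.reflect.Hm_level (l := l) (by simpa using hl)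
  rw [hS] at h1 h2 h3
  refine ⟨by simpa using h1, by linarith, fun p => ?_⟩
  rw [Hp_eq_Hm_reflect, h3, neg_le_neg_iff]

theorem A1cond.trunc_Hp_lipschitz (h : A1cond H p₀) {L b : ℝ} (hb : p₀ ≤ b)
    (hL : ∀ p ∈ Icc p₀ b, |deriv H p| ≤ L) {p q : ℝ} (hpq : p ≤ q) :
    min (Hp H p₀ q) (H b) - min (Hp H p₀ p) (H b) ≤ L * (q - p) := by
  have h1 := h.reflect.trunc_Hm_lipschitz (L := L) (a := -b) (neg_le_neg hb)
    (fun r hr => by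
      rw [deriv_comp_neg, abs_neg]
      exact hL (-r) ⟨by linarith [hr.2], by linarith [hr.1]⟩) (neg_le_neg hpq)
  simp only [neg_neg, ← Hp_eq_Hm_reflect] at h1
  linarith

end Envelopes

section Scheme

variable {N : ℕ} {H : Fin N → ℝ → ℝ} {p₀ : Fin N → ℝ} {Δx Δt : ℝ}

theorem SchemeStep.le_sub_Hm {U V : Fin N → ℕ → ℝ} (h : SchemeStep H p₀ Δx Δt U V)
    (hΔt : 0 < Δt) (α : Fin N) (i : ℕ) :
    V α i ≤ U α i - Δt * Hm (H α) (p₀ α) ((U α (i + 1) - U α i) / Δx) := by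
  rcases Nat.eq_zero_or_pos i with rfl | hi
  · rw [h.2.2 α]
    gcongr
    exact le_csSup (finite_range _).bddAbove ⟨α, rfl⟩
  · rw [h.1 α i hi]
    gcongr
    exact le_max_right _ _

theorem SchemeStep.le_sub_Hp {U V : Fin N → ℕ → ℝ} (h : SchemeStep H p₀ Δx Δt U V)
    (hΔt : 0 < Δt) (α : Fin N) (i : ℕ) :
    V α (i + 1) ≤ U α (i + 1) - Δt * Hp (H α) (p₀ α) ((U α (i + 1) - U α i) / Δx) := by
  rw [h.1 α (i + 1) (Nat.succ_pos i)]
  gcongr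
  exact le_max_left _ _

theorem SchemeStep.eq_succ {U V : Fin N → ℕ → ℝ} (h : SchemeStep H p₀ Δx Δt U V)
    (α : Fin N) (i : ℕ) :
    V α (i + 1) = U α (i + 1) - Δt * Hp (H α) (p₀ α) ((U α (i + 1) - U α i) / Δx) ∨
    V α (i + 1) =
      U α (i + 1) - Δt * Hm (H α) (p₀ α) ((U α (i + 1 + 1) - U α (i + 1)) / Δx) := by
  have h1 := h.1 α (i + 1) (Nat.succ_pos i)
  rw [Nat.add_sub_cancel] at h1
  rcases max_choice (Hp (H α) (p₀ α) ((U α (i + 1) - U α i) / Δx))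
    (Hm (H α) (p₀ α) ((U α (i + 1 + 1) - U α (i + 1)) / Δx)) with h2 | h2
  · exact Or.inl (h2 ▸ h1)
  · exact Or.inr (h2 ▸ h1)

theorem SchemeStep.eq_zero {U V : Fin N → ℕ → ℝ} (h : SchemeStep H p₀ Δx Δt U V)
    (α : Fin N) :
    ∃ β, V α 0 = U β 0 - Δt * Hm (H β) (p₀ β) ((U β 1 - U β 0) / Δx) := by
  have : Nonempty (Fin N) := ⟨α⟩
  obtain ⟨β, hβ⟩ := (range_nonempty fun β : Fin N =>
    Hm (H β) (p₀ β) ((U β 1 - U β 0) / Δx)).csSup_mem (finite_range _)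
  refine ⟨β, ?_⟩
  simp only at hβ
  rw [h.2.2 α, ← hβ, h.2.1 α β]

theorem SchemeStep.sub_le {U V : Fin N → ℕ → ℝ} (h : SchemeStep H p₀ Δx Δt U V)
    (hΔt : 0 < Δt) {l : ℝ}
    (hm : ∀ α i, Hm (H α) (p₀ α) ((U α (i + 1) - U α i) / Δx) ≤ l)
    (hp : ∀ α i, Hp (H α) (p₀ α) ((U α (i + 1) - U α i) / Δx) ≤ l)
    (α : Fin N) (i : ℕ) : U α i - Δt * l ≤ V α i := by
  cases i with
  | zero =>
    obtain ⟨β, hβ⟩ := h.eq_zero α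
    rw [hβ, h.2.1 α β]
    gcongr
    exact hm β 0
  | succ i =>
    rcases h.eq_succ α i with h1 | h1 <;> rw [h1] <;> gcongr
    · exact hp α i
    · exact hm α (i + 1)

/-- The invariant region of the scheme: all discrete slopes stay in the sublevel sets
`{H⁻ ≤ l}` and `{H⁺ ≤ l}`, and the envelopes truncated at level `l` have Lipschitz constant
`Δx / Δt`. -/
structure SlopeBound (H : Fin N → ℝ → ℝ) (p₀ : Fin N → ℝ) (Δx Δt : ℝ)
    (U : Fin N → ℕ → ℕ → ℝ) (l : ℝ) : Prop where
  hm : ∀ n α i, Hm (H α) (p₀ α) ((U α n (i + 1) - U α n i) / Δx) ≤ l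
  hp : ∀ n α i, Hp (H α) (p₀ α) ((U α n (i + 1) - U α n i) / Δx) ≤ l
  lipm : ∀ α p q, p ≤ q →
    min (Hm (H α) (p₀ α) p) l - min (Hm (H α) (p₀ α) q) l ≤ Δx / Δt * (q - p)
  lipp : ∀ α p q, p ≤ q →
    min (Hp (H α) (p₀ α) q) l - min (Hp (H α) (p₀ α) p) l ≤ Δx / Δt * (q - p)

theorem SchemeNS.exists_slopeBound (hN : 1 ≤ N) (hA1 : ∀ α, A1cond (H α) (p₀ α))
    (hΔx : 0 < Δx) (hΔt : 0 < Δt) {U : Fin N → ℕ → ℕ → ℝ} (hU : SchemeNS H p₀ Δx Δt U)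
    {M : ℝ} (hMm : ∀ α i, Hm (H α) (p₀ α) ((U α 0 (i + 1) - U α 0 i) / Δx) ≤ M)
    (hMp : ∀ α i, Hp (H α) (p₀ α) ((U α 0 (i + 1) - U α 0 i) / Δx) ≤ M)
    (hCFL : CFLprime H p₀ Δx Δt U) :
    ∃ l ≤ M, SlopeBound H p₀ Δx Δt U l := by
  have : Nonempty (Fin N) := ⟨⟨0, hN⟩⟩
  unfold CFLprime at hCFL
  set l := -(sInf (Set.range fun q : Fin N × ℕ => (U q.1 1 q.2 - U q.1 0 q.2) / Δt)) with hl
  have hge : ∀ q : Fin N × ℕ, -M ≤ (U q.1 1 q.2 - U q.1 0 q.2) / Δt := by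
    intro q
    rw [le_div_iff₀ hΔt]
    linarith [(hU 0).sub_le hΔt hMm hMp q.1 q.2]
  have hbdd : BddBelow (Set.range fun q : Fin N × ℕ => (U q.1 1 q.2 - U q.1 0 q.2) / Δt) :=
    ⟨-M, by rintro _ ⟨q, rfl⟩; exact hge q⟩
  have hlM : l ≤ M := by
    have : -M ≤ sInf (Set.range fun q : Fin N × ℕ => (U q.1 1 q.2 - U q.1 0 q.2) / Δt) :=
      le_csInf (range_nonempty _) (by rintro _ ⟨q, rfl⟩; exact hge q)
    linarith
  have hW : ∀ α i, U α 0 i - Δt * l ≤ U α 1 i := by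
    intro α i
    have h1 := csInf_le hbdd ⟨(α, i), rfl⟩
    simp only at h1
    rw [le_div_iff₀ hΔt] at h1
    rw [hl]
    linarith
  have hm0 : ∀ α i, Hm (H α) (p₀ α) ((U α 0 (i + 1) - U α 0 i) / Δx) ≤ l := by
    intro α i
    refine le_of_mul_le_mul_left ?_ hΔt
    have := (hU 0).le_sub_Hm hΔt α i
    have := hW α i
    simp only [zero_add] at *
    linarith
  have hp0 : ∀ α i, Hp (H α) (p₀ α) ((U α 0 (i + 1) - U α 0 i) / Δx) ≤ l := by
    intro α i
    refine le_of_mul_le_mul_left ?_ hΔt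
    have := (hU 0).le_sub_Hp hΔt α i
    have := hW α (i + 1)
    simp only [zero_add] at *
    linarith
  have hl0 : ∀ α, H α (p₀ α) ≤ l := fun α => ((hA1 α).min_le_Hm _).trans (hm0 α 0)
  have hlipm : ∀ α p q, p ≤ q →
      min (Hm (H α) (p₀ α) p) l - min (Hm (H α) (p₀ α) q) l ≤ Δx / Δt * (q - p) := by
    intro α p q hpq
    obtain ⟨h1, h2, -⟩ := (hA1 α).Hm_level (hl0 α)
    have := (hA1 α).trunc_Hm_lipschitz h2 (L := Δx / Δt)
      (fun r hr => hCFL α r ⟨hr.1, hr.2.trans ((hA1 α).Hp_level (hl0 α)).2.1⟩) hpq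
    rwa [h1] at this
  have hlipp : ∀ α p q, p ≤ q →
      min (Hp (H α) (p₀ α) q) l - min (Hp (H α) (p₀ α) p) l ≤ Δx / Δt * (q - p) := by
    intro α p q hpq
    obtain ⟨h1, h2, -⟩ := (hA1 α).Hp_level (hl0 α)
    have := (hA1 α).trunc_Hp_lipschitz h2 (L := Δx / Δt)
      (fun r hr => hCFL α r ⟨((hA1 α).Hm_level (hl0 α)).2.1.trans hr.1, hr.2⟩) hpq
    rwa [h1] at this
  have main : ∀ n, (∀ α i, Hm (H α) (p₀ α) ((U α n (i + 1) - U α n i) / Δx) ≤ l) ∧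
      ∀ α i, Hp (H α) (p₀ α) ((U α n (i + 1) - U α n i) / Δx) ≤ l := by
    intro n
    induction n with
    | zero => exact ⟨hm0, hp0⟩
    | succ n ih =>
      obtain ⟨ihm, ihp⟩ := ih
      have hL : 0 < Δx / Δt := div_pos hΔx hΔt
      refine ⟨fun α i => ?_, fun α i => ?_⟩
      · obtain ⟨h1, h2, h3⟩ := (hA1 α).Hm_level (hl0 α)
        have hap := (h3 _).1 (ihm α i)
        rw [h3]
        have hG := hlipm α _ _ hap
        rw [min_eq_left (ihm α i), min_eq_right ((by
          rw [Hm_eq_min, min_eq_left h2, h1] : l ≤ Hm (H α) (p₀ α) _))] at hG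
        have h4 := (hU n).le_sub_Hm hΔt α i
        have h5 := (hU n).sub_le hΔt ihm ihp α (i + 1)
        rw [div_mul_eq_mul_div, le_div_iff₀ hΔt, mul_sub, mul_div_cancel₀ _ hΔx.ne'] at hG
        rw [le_div_iff₀ hΔx]
        linarith
      · obtain ⟨h1, h2, h3⟩ := (hA1 α).Hp_level (hl0 α)
        have hap := (h3 _).1 (ihp α i)
        rw [h3]
        have hG := hlipp α _ _ hap
        rw [min_eq_left (ihp α i), min_eq_right ((by
          rw [Hp_eq_Hm_reflect, Hm_eq_min, min_eq_left (neg_le_neg h2), neg_neg, h1] :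
            l ≤ Hp (H α) (p₀ α) _))] at hG
        have h4 := (hU n).le_sub_Hp hΔt α i
        have h5 := (hU n).sub_le hΔt ihm ihp α i
        rw [div_mul_eq_mul_div, le_div_iff₀ hΔt, mul_sub, mul_div_cancel₀ _ hΔx.ne'] at hG
        rw [div_le_iff₀ hΔx]
        linarith
  exact ⟨l, hlM, fun n => (main n).1, fun n => (main n).2, hlipm, hlipp⟩

/-- Monotonicity of the explicit upwind step under the CFL bound, for a non-increasing flux. -/
theorem sub_mul_flux_le (hΔx : 0 < Δx) (hΔt : 0 < Δt) {G : ℝ → ℝ} (hG : Antitone G)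
    (hlip : ∀ p q, p ≤ q → G p - G q ≤ Δx / Δt * (q - p)) {y z y' z' : ℝ}
    (hy : y ≤ y') (hz : z ≤ z') :
    y - Δt * G ((z - y) / Δx) ≤ y' - Δt * G ((z' - y') / Δx) := by
  have h1 : G ((z' - y') / Δx) ≤ G ((z - y') / Δx) := hG (by gcongr)
  have h2 := hlip ((z - y') / Δx) ((z - y) / Δx) (by gcongr)
  have h3 : Δx / Δt * ((z - y) / Δx - (z - y') / Δx) = (y' - y) / Δt := by
    field_simp
    ring
  rw [h3, le_div_iff₀ hΔt] at h2
  nlinarith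

/-- Monotonicity of the explicit upwind step under the CFL bound, for a non-decreasing flux. -/
theorem sub_mul_flux_le' (hΔx : 0 < Δx) (hΔt : 0 < Δt) {G : ℝ → ℝ} (hG : Monotone G)
    (hlip : ∀ p q, p ≤ q → G q - G p ≤ Δx / Δt * (q - p)) {y x y' x' : ℝ}
    (hy : y ≤ y') (hx : x ≤ x') :
    y - Δt * G ((y - x) / Δx) ≤ y' - Δt * G ((y' - x') / Δx) := by
  have h := sub_mul_flux_le hΔx hΔt (G := fun p => G (-p)) (fun p q hpq => hG (neg_le_neg hpq))
    (fun p q hpq => by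
      have := hlip (-q) (-p) (neg_le_neg hpq)
      linarith) hy hx
  simpa only [← neg_div, neg_sub] using h

theorem SchemeNS.eq_at_zero {U : Fin N → ℕ → ℕ → ℝ} (hU : SchemeNS H p₀ Δx Δt U)
    (α β : Fin N) (n : ℕ) : U α n 0 = U β n 0 :=
  (hU n).2.1 α β

end Scheme

section Comparison

variable {N : ℕ} {H : Fin N → ℝ → ℝ} {p₀ : Fin N → ℝ} {Δx Δt l : ℝ} {U : Fin N → ℕ → ℕ → ℝ}

theorem SlopeBound.test_above_Hm (hS : SlopeBound H p₀ Δx Δt U l)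
    (hA1 : ∀ α, A1cond (H α) (p₀ α)) (hΔx : 0 < Δx) (hΔt : 0 < Δt)
    (hU : SchemeNS H p₀ Δx Δt U) {f : ℕ → ℕ → ℝ} {α : Fin N} {n i : ℕ}
    (h00 : U α n i ≤ f n i) (h01 : U α n (i + 1) ≤ f n (i + 1))
    (h10 : U α (n + 1) i = f (n + 1) i) (h11 : U α (n + 1) (i + 1) ≤ f (n + 1) (i + 1)) :
    (f (n + 1) i - f n i) / Δt + min (Hm (H α) (p₀ α) ((f n (i + 1) - f n i) / Δx))
      (Hm (H α) (p₀ α) ((f (n + 1) (i + 1) - f (n + 1) i) / Δx)) ≤ 0 := by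
  have hG : Antitone fun p => min (Hm (H α) (p₀ α) p) l :=
    fun p q hpq => min_le_min_right _ ((hA1 α).antitone_Hm hpq)
  have h1 := sub_mul_flux_le hΔx hΔt hG (hS.lipm α) h00 h01
  simp only [min_eq_left (hS.hm n α i)] at h1
  have h2 := (hU n).le_sub_Hm hΔt α i
  have h3 : Hm (H α) (p₀ α) ((f (n + 1) (i + 1) - f (n + 1) i) / Δx) ≤ l :=
    ((hA1 α).antitone_Hm (by rw [h10]; gcongr)).trans (hS.hm (n + 1) α i)
  have h4 : min (Hm (H α) (p₀ α) ((f n (i + 1) - f n i) / Δx))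
      (Hm (H α) (p₀ α) ((f (n + 1) (i + 1) - f (n + 1) i) / Δx)) ≤
      min (Hm (H α) (p₀ α) ((f n (i + 1) - f n i) / Δx)) l := min_le_min_left _ h3
  have h5 : (f (n + 1) i - f n i) / Δt ≤ -min (Hm (H α) (p₀ α) ((f n (i + 1) - f n i) / Δx)) l := by
    rw [div_le_iff₀ hΔt]
    linarith
  linarith

theorem SlopeBound.test_above_Hp (hS : SlopeBound H p₀ Δx Δt U l)
    (hA1 : ∀ α, A1cond (H α) (p₀ α)) (hΔx : 0 < Δx) (hΔt : 0 < Δt)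
    (hU : SchemeNS H p₀ Δx Δt U) {f : ℕ → ℕ → ℝ} {α : Fin N} {n i : ℕ}
    (h00 : U α n i ≤ f n i) (h01 : U α n (i + 1) ≤ f n (i + 1))
    (h10 : U α (n + 1) i ≤ f (n + 1) i) (h11 : U α (n + 1) (i + 1) = f (n + 1) (i + 1)) :
    (f (n + 1) (i + 1) - f n (i + 1)) / Δt +
      min (Hp (H α) (p₀ α) ((f n (i + 1) - f n i) / Δx))
        (Hp (H α) (p₀ α) ((f (n + 1) (i + 1) - f (n + 1) i) / Δx)) ≤ 0 := by
  have hG : Monotone fun p => min (Hp (H α) (p₀ α) p) l :=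
    fun p q hpq => min_le_min_right _ ((hA1 α).monotone_Hp hpq)
  have h1 := sub_mul_flux_le' hΔx hΔt hG (hS.lipp α) h01 h00
  simp only [min_eq_left (hS.hp n α i)] at h1
  have h2 := (hU n).le_sub_Hp hΔt α i
  have h3 : Hp (H α) (p₀ α) ((f (n + 1) (i + 1) - f (n + 1) i) / Δx) ≤ l :=
    ((hA1 α).monotone_Hp (by rw [h11]; gcongr)).trans (hS.hp (n + 1) α i)
  have h4 : min (Hp (H α) (p₀ α) ((f n (i + 1) - f n i) / Δx))
      (Hp (H α) (p₀ α) ((f (n + 1) (i + 1) - f (n + 1) i) / Δx)) ≤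
      min (Hp (H α) (p₀ α) ((f n (i + 1) - f n i) / Δx)) l := min_le_min_left _ h3
  have h5 : (f (n + 1) (i + 1) - f n (i + 1)) / Δt ≤
      -min (Hp (H α) (p₀ α) ((f n (i + 1) - f n i) / Δx)) l := by
    rw [div_le_iff₀ hΔt]
    linarith
  linarith

theorem SlopeBound.test_below_succ (hS : SlopeBound H p₀ Δx Δt U l)
    (hA1 : ∀ α, A1cond (H α) (p₀ α)) (hΔx : 0 < Δx) (hΔt : 0 < Δt)
    (hU : SchemeNS H p₀ Δx Δt U) {f : ℕ → ℕ → ℝ} {α : Fin N} {n i : ℕ}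
    (h0 : f n i ≤ U α n i) (h1 : f n (i + 1) ≤ U α n (i + 1))
    (h2 : f n (i + 1 + 1) ≤ U α n (i + 1 + 1))
    (h11 : f (n + 1) (i + 1) = U α (n + 1) (i + 1)) :
    0 ≤ (f (n + 1) (i + 1) - f n (i + 1)) / Δt +
      max (Hp (H α) (p₀ α) ((f n (i + 1) - f n i) / Δx))
        (Hm (H α) (p₀ α) ((f n (i + 1 + 1) - f n (i + 1)) / Δx)) := by
  rcases (hU n).eq_succ α i with h | h
  · have hG : Monotone fun p => min (Hp (H α) (p₀ α) p) l :=
      fun p q hpq => min_le_min_right _ ((hA1 α).monotone_Hp hpq)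
    have h3 := sub_mul_flux_le' hΔx hΔt hG (hS.lipp α) h1 h0
    simp only [min_eq_left (hS.hp n α i)] at h3
    have h4 : Δt * min (Hp (H α) (p₀ α) ((f n (i + 1) - f n i) / Δx)) l ≤
        Δt * max (Hp (H α) (p₀ α) ((f n (i + 1) - f n i) / Δx))
          (Hm (H α) (p₀ α) ((f n (i + 1 + 1) - f n (i + 1)) / Δx)) := by
      gcongr
      exact (min_le_left _ _).trans (le_max_left _ _)
    rw [← sub_le_iff_le_add, zero_sub, le_div_iff₀ hΔt]
    linarith
  · have hG : Antitone fun p => min (Hm (H α) (p₀ α) p) l :=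
      fun p q hpq => min_le_min_right _ ((hA1 α).antitone_Hm hpq)
    have h3 := sub_mul_flux_le hΔx hΔt hG (hS.lipm α) h1 h2
    simp only [min_eq_left (hS.hm n α (i + 1))] at h3
    have h4 : Δt * min (Hm (H α) (p₀ α) ((f n (i + 1 + 1) - f n (i + 1)) / Δx)) l ≤
        Δt * max (Hp (H α) (p₀ α) ((f n (i + 1) - f n i) / Δx))
          (Hm (H α) (p₀ α) ((f n (i + 1 + 1) - f n (i + 1)) / Δx)) := by
      gcongr
      exact (min_le_left _ _).trans (le_max_right _ _)
    rw [← sub_le_iff_le_add, zero_sub, le_div_iff₀ hΔt]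
    linarith

theorem SlopeBound.test_below_zero (hS : SlopeBound H p₀ Δx Δt U l)
    (hA1 : ∀ α, A1cond (H α) (p₀ α)) (hΔx : 0 < Δx) (hΔt : 0 < Δt)
    (hU : SchemeNS H p₀ Δx Δt U) {f : Fin N → ℕ → ℕ → ℝ} {n : ℕ}
    (h0 : ∀ α, f α n 0 ≤ U α n 0) (h1 : ∀ α, f α n 1 ≤ U α n 1)
    (h10 : ∀ α, f α (n + 1) 0 = U α (n + 1) 0) (α : Fin N) :
    ∃ β, 0 ≤ (f β (n + 1) 0 - f β n 0) / Δt +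
      Hm (H β) (p₀ β) ((f β n 1 - f β n 0) / Δx) := by
  obtain ⟨β, h⟩ := (hU n).eq_zero α
  refine ⟨β, ?_⟩
  have hG : Antitone fun p => min (Hm (H β) (p₀ β) p) l :=
    fun p q hpq => min_le_min_right _ ((hA1 β).antitone_Hm hpq)
  have h3 := sub_mul_flux_le hΔx hΔt hG (hS.lipm β) (h0 β) (h1 β)
  have h5 := hS.hm n β 0
  rw [zero_add] at h5
  simp only [min_eq_left h5] at h3
  have h4 : Δt * min (Hm (H β) (p₀ β) ((f β n 1 - f β n 0) / Δx)) l ≤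
      Δt * Hm (H β) (p₀ β) ((f β n 1 - f β n 0) / Δx) := by
    gcongr
    exact min_le_left _ _
  have h6 := hU.eq_at_zero α β (n + 1)
  have h7 := h10 β
  rw [← sub_le_iff_le_add, zero_sub, le_div_iff₀ hΔt]
  linarith

end Comparison

section StrictDiff

/-- `f` is strictly differentiable at `(t, x)` relative to the half plane `{x ≥ 0}`, with partial
derivatives `a` in time and `b` in space. -/
def StrictDiff (f : ℝ → ℝ → ℝ) (t x a b : ℝ) : Prop :=
  ∀ ε > 0, ∃ ρ > 0, ∀ s s' y y', |s - t| < ρ → |s' - t| < ρ → |y - x| < ρ → |y' - x| < ρ →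
    0 ≤ y → 0 ≤ y' → |f s y - f s' y' - a * (s - s') - b * (y - y')| ≤ ε * (|s - s'| + |y - y'|)

variable {f g : ℝ → ℝ → ℝ} {t x a b a' b' : ℝ}

theorem StrictDiff.add (hf : StrictDiff f t x a b) (hg : StrictDiff g t x a' b') :
    StrictDiff (fun s y => f s y + g s y) t x (a + a') (b + b') := by
  intro ε hε
  obtain ⟨ρ, hρ, h1⟩ := hf (ε / 2) (half_pos hε)
  obtain ⟨ρ', hρ', h2⟩ := hg (ε / 2) (half_pos hε)
  refine ⟨min ρ ρ', lt_min hρ hρ', fun s s' y y' hs hs' hy hy' h0 h0' => ?_⟩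
  rw [lt_min_iff] at hs hs' hy hy'
  have h3 := h1 s s' y y' hs.1 hs'.1 hy.1 hy'.1 h0 h0'
  have h4 := h2 s s' y y' hs.2 hs'.2 hy.2 hy'.2 h0 h0'
  have h5 := abs_add_le (f s y - f s' y' - a * (s - s') - b * (y - y'))
    (g s y - g s' y' - a' * (s - s') - b' * (y - y'))
  calc _ = |(f s y - f s' y' - a * (s - s') - b * (y - y')) +
        (g s y - g s' y' - a' * (s - s') - b' * (y - y'))| := by ring_nf
    _ ≤ _ := by linarith

theorem strictDiff_linear (c t x : ℝ) : StrictDiff (fun _ y => c * y) t x 0 c := by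
  intro ε hε
  refine ⟨1, one_pos, fun s s' y y' _ _ _ _ _ _ => ?_⟩
  rw [show c * y - c * y' - 0 * (s - s') - c * (y - y') = 0 by ring, abs_zero]
  positivity

theorem strictDiff_sq (c t x : ℝ) :
    StrictDiff (fun s y => c * ((s - t) ^ 2 + (y - x) ^ 2)) t x 0 0 := by
  intro ε hε
  refine ⟨ε / (2 * (|c| + 1)), by positivity, fun s s' y y' hs hs' hy hy' _ _ => ?_⟩
  have hc : 0 < 2 * (|c| + 1) := by positivity
  rw [lt_div_iff₀ hc] at hs hs' hy hy'
  have h1 : c * ((s - t) ^ 2 + (y - x) ^ 2) - c * ((s' - t) ^ 2 + (y' - x) ^ 2)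
      - 0 * (s - s') - 0 * (y - y') =
      (c * ((s - t) + (s' - t))) * (s - s') + (c * ((y - x) + (y' - x))) * (y - y') := by ring
  have h2 : ∀ p q : ℝ, |p| * (2 * (|c| + 1)) < ε → |q| * (2 * (|c| + 1)) < ε →
      |c * (p + q)| ≤ ε := by
    intro p q hp hq
    rw [abs_mul]
    have := mul_le_mul_of_nonneg_left (abs_add_le p q) (abs_nonneg c)
    nlinarith [abs_nonneg p, abs_nonneg q]
  rw [h1]
  refine (abs_add_le _ _).trans ?_
  rw [abs_mul, abs_mul _ (y - y'), mul_add ε]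
  gcongr
  · exact h2 _ _ hs hs'
  · exact h2 _ _ hy hy'

theorem StrictDiff.exists_dist_le (hf : StrictDiff f t x a b) {ε : ℝ} (hε : 0 < ε) :
    ∃ η > 0, ∀ s y, |s - t| < η → |y - x| < η → 0 ≤ x → 0 ≤ y → |f s y - f t x| ≤ ε := by
  obtain ⟨ρ, hρ, h⟩ := hf 1 one_pos
  have hM : 0 < |a| + |b| + 2 := by positivity
  refine ⟨min ρ (ε / (|a| + |b| + 2)), by positivity, fun s y hs hy hx hy0 => ?_⟩
  rw [lt_min_iff, lt_div_iff₀ hM] at hs hy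
  have h1 := h s t y x hs.1 (by simpa using hρ) hy.1 (by simpa using hρ) hy0 hx
  have h2 : |f s y - f t x| ≤ |f s y - f t x - a * (s - t) - b * (y - x)| +
      (|a| * |s - t| + |b| * |y - x|) := by
    rw [← abs_mul, ← abs_mul]
    calc _ = |(f s y - f t x - a * (s - t) - b * (y - x)) + (a * (s - t) + b * (y - x))| := by
          ring_nf
      _ ≤ _ := (abs_add_le _ _).trans (by gcongr; exact abs_add_le _ _)
  have h3 := mul_le_mul_of_nonneg_left hs.2.le (abs_nonneg a)
  nlinarith [abs_nonneg a, abs_nonneg b, abs_nonneg (s - t), abs_nonneg (y - x)]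

theorem StrictDiff.exists_quotients (hf : StrictDiff f t x a b) {ε : ℝ} (hε : 0 < ε) :
    ∃ ρ > 0, ∀ Δx Δt : ℝ, 0 < Δx → 0 < Δt → ∀ n i : ℕ,
      |n * Δt - t| < ρ → |i * Δx - x| < ρ →
      (|(n + 1 : ℕ) * Δt - t| < ρ →
        |(f ((n + 1 : ℕ) * Δt) (i * Δx) - f (n * Δt) (i * Δx)) / Δt - a| ≤ ε) ∧
      (|(i + 1 : ℕ) * Δx - x| < ρ →
        |(f (n * Δt) ((i + 1 : ℕ) * Δx) - f (n * Δt) (i * Δx)) / Δx - b| ≤ ε) := by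
  obtain ⟨ρ, hρ, h⟩ := hf ε hε
  refine ⟨ρ, hρ, fun Δx Δt hΔx hΔt n i hn hi => ⟨fun hn' => ?_, fun hi' => ?_⟩⟩
  · have h1 := h _ _ _ _ hn' hn hi hi (by positivity) (by positivity)
    have e : ((n + 1 : ℕ) : ℝ) * Δt - n * Δt = Δt := by push_cast; ring
    rw [e, sub_self, mul_zero, sub_zero, abs_zero, add_zero, abs_of_pos hΔt] at h1
    rw [div_sub' hΔt.ne', abs_div, abs_of_pos hΔt, div_le_iff₀ hΔt, mul_comm Δt a]
    exact h1
  · have h1 := h _ _ _ _ hn hn hi' hi (by positivity) (by positivity)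
    have e : ((i + 1 : ℕ) : ℝ) * Δx - i * Δx = Δx := by push_cast; ring
    rw [e, sub_self, mul_zero, sub_zero, abs_zero, zero_add, abs_of_pos hΔx] at h1
    rw [div_sub' hΔx.ne', abs_div, abs_of_pos hΔx, div_le_iff₀ hΔx, mul_comm Δx b]
    exact h1

/-- A function that is `C¹` up to the boundary is strictly differentiable. -/
theorem ContDiffOn.strictDiff {T : ℝ}
    (hf : ContDiffOn ℝ 1 (fun q : ℝ × ℝ => f q.1 q.2) (Ioo 0 T ×ˢ Ici 0))
    (ht : t ∈ Ioo 0 T) (hx : 0 ≤ x) :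
    StrictDiff f t x (deriv (fun s => f s x) t) (derivWithin (fun y => f t y) (Ici 0) x) := by
  set S : Set (ℝ × ℝ) := Ioo 0 T ×ˢ Ici 0 with hS
  set F : ℝ × ℝ → ℝ := fun q => f q.1 q.2 with hF
  have hu : UniqueDiffOn ℝ S := isOpen_Ioo.uniqueDiffOn.prod (uniqueDiffOn_Ici 0)
  have hP : (t, x) ∈ S := ⟨ht, hx⟩
  have hd : ∀ q ∈ S, HasFDerivWithinAt F (fderivWithin ℝ F S q) S q := fun q hq =>
    (hf.differentiableOn one_ne_zero q hq).hasFDerivWithinAt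
  set D := fderivWithin ℝ F S (t, x) with hD
  have hDa : deriv (fun s => f s x) t = D (1, 0) := by
    have h1 : HasDerivAt (fun s : ℝ => (s, x)) ((1 : ℝ), (0 : ℝ)) t :=
      (hasDerivAt_id t).prodMk (hasDerivAt_const t x)
    have h2 := (hd _ hP).comp_hasDerivWithinAt (s := Ioo 0 T) t h1.hasDerivWithinAt
      (fun s (hs : s ∈ Ioo 0 T) => (⟨hs, hx⟩ : (s, x) ∈ S))
    exact (h2.hasDerivAt (Ioo_mem_nhds ht.1 ht.2)).deriv
  have hDb : derivWithin (fun y => f t y) (Ici 0) x = D (0, 1) := by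
    have h1 : HasDerivAt (fun y : ℝ => (t, y)) ((0 : ℝ), (1 : ℝ)) x :=
      (hasDerivAt_const x t).prodMk (hasDerivAt_id x)
    have h2 := (hd _ hP).comp_hasDerivWithinAt (s := Ici 0) x h1.hasDerivWithinAt
      (fun y (hy : y ∈ Ici 0) => (⟨ht, hy⟩ : (t, y) ∈ S))
    exact h2.derivWithin (uniqueDiffOn_Ici 0 x hx)
  intro ε hε
  have hc := hf.continuousOn_fderivWithin hu le_rfl (t, x) hP
  obtain ⟨ρ, hρ, hball⟩ := Metric.continuousWithinAt_iff.1 hc ε hε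
  refine ⟨min ρ (min t (T - t)), lt_min hρ (lt_min ht.1 (sub_pos.2 ht.2)),
    fun s s' y y' hs hs' hy hy' h0 h0' => ?_⟩
  have hmem : ∀ s y, |s - t| < min ρ (min t (T - t)) → |y - x| < min ρ (min t (T - t)) → 0 ≤ y →
      (s, y) ∈ Metric.ball (t, x) ρ ∩ S := by
    intro s y hs hy h0
    rw [lt_min_iff, lt_min_iff] at hs hy
    refine ⟨?_, ⟨?_, ?_⟩, h0⟩
    · rw [Metric.mem_ball, Prod.dist_eq, max_lt_iff]
      exact ⟨hs.1, hy.1⟩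
    · linarith [(abs_lt.1 hs.2.1).1]
    · linarith [(abs_lt.1 hs.2.2).2]
  have hconv : Convex ℝ (Metric.ball (t, x) ρ ∩ S) :=
    (convex_ball _ _).inter ((convex_Ioo 0 T).prod (convex_Ici 0))
  have h1 := hconv.norm_image_sub_le_of_norm_hasFDerivWithin_le' (f := F) (φ := D) (C := ε)
    (f' := fderivWithin ℝ F S) (fun q hq => (hd q hq.2).mono inter_subset_right)
    (fun q hq => by
      rw [← dist_eq_norm]
      exact (hball hq.2 hq.1).le) (hmem s' y' hs' hy' h0') (hmem s y hs hy h0)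
  have h2 : D ((s, y) - (s', y')) = D (1, 0) * (s - s') + D (0, 1) * (y - y') := by
    have : ((s, y) - (s', y') : ℝ × ℝ) = (s - s') • ((1 : ℝ), (0 : ℝ)) +
        (y - y') • ((0 : ℝ), (1 : ℝ)) := by simp
    rw [this, map_add, map_smul, map_smul, smul_eq_mul, smul_eq_mul]
    ring
  rw [h2] at h1
  rw [hDa, hDb, sub_sub]
  refine h1.trans ?_
  gcongr
  rw [Prod.norm_def]
  exact max_le (le_add_of_nonneg_right (abs_nonneg _)) (le_add_of_nonneg_left (abs_nonneg _))

end StrictDiff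

section DiscreteMax

theorem abs_floor_mul_sub_le {d t : ℝ} (hd : 0 < d) (ht : 0 ≤ t) :
    |(⌊t / d⌋₊ : ℝ) * d - t| ≤ d := by
  have h1 := Nat.floor_le (div_nonneg ht hd.le)
  have h2 := (Nat.lt_floor_add_one (t / d)).le
  rw [le_div_iff₀ hd] at h1
  rw [div_le_iff₀ hd] at h2
  rw [abs_le]
  constructor <;> linarith

/-- If grid functions `V k` converge uniformly near `(t, x)` to functions `g γ` that are
nonpositive and one of which vanishes at `(t, x)`, then the quadratically penalized `V k` have
maximum points tending to `(t, x)`. -/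
theorem exists_discrete_max {ι : Type*} (A : Finset ι) (g : ι → ℝ → ℝ → ℝ)
    (V : ℕ → ι → ℕ → ℕ → ℝ) {Δx Δt : ℕ → ℝ} (hΔx : ∀ k, 0 < Δx k) (hΔt : ∀ k, 0 < Δt k)
    (hΔx0 : Tendsto Δx atTop (nhds 0)) (hΔt0 : Tendsto Δt atTop (nhds 0))
    {t x r : ℝ} (ht : 0 ≤ t) (hx : 0 ≤ x) (hr : 0 < r) {γ₀ : ι} (hγ₀ : γ₀ ∈ A)
    (hg : ∀ γ ∈ A, ∀ s y, |s - t| ≤ r → |y - x| ≤ r → 0 ≤ y → g γ s y ≤ 0)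
    (hg₀ : ∀ δ > 0, ∃ η > 0, ∀ s y, |s - t| < η → |y - x| < η → 0 ≤ y → -δ ≤ g γ₀ s y)
    (hV : ∀ δ > 0, ∀ᶠ k in atTop, ∀ γ ∈ A, ∀ n i : ℕ, |n * Δt k - t| ≤ r → |i * Δx k - x| ≤ r →
      |V k γ n i - g γ (n * Δt k) (i * Δx k)| ≤ δ) {ρ : ℝ} (hρ : 0 < ρ) :
    ∀ᶠ k in atTop, ∃ β ∈ A, ∃ n i : ℕ, |n * Δt k - t| < ρ ∧ |i * Δx k - x| < ρ ∧
      ∀ γ ∈ A, ∀ m j : ℕ, |m * Δt k - t| ≤ r → |j * Δx k - x| ≤ r →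
        V k γ m j - ((m * Δt k - t) ^ 2 + (j * Δx k - x) ^ 2) ≤
          V k β n i - ((n * Δt k - t) ^ 2 + (i * Δx k - x) ^ 2) := by
  have hδ : 0 < ρ ^ 2 / 8 := by positivity
  obtain ⟨η, hη, hη'⟩ := hg₀ _ hδ
  have hsmall : 0 < min η (min r (ρ / 4)) := by positivity
  filter_upwards [hV _ hδ, hΔx0.eventually_lt_const hsmall, hΔt0.eventually_lt_const hsmall]
    with k hVk hxk htk
  rw [lt_min_iff, lt_min_iff] at hxk htk
  have hfin : {p : ι × ℕ × ℕ | p.1 ∈ A ∧ |p.2.1 * Δt k - t| ≤ r ∧ |p.2.2 * Δx k - x| ≤ r}.Finite := by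
    refine (A.finite_toSet.prod ((finite_Iic ⌊(t + r) / Δt k⌋₊).prod
      (finite_Iic ⌊(x + r) / Δx k⌋₊))).subset ?_
    rintro ⟨γ, m, j⟩ ⟨h1, h2, h3⟩
    refine ⟨h1, Nat.le_floor ?_, Nat.le_floor ?_⟩
    · rw [le_div_iff₀ (hΔt k)]
      linarith [(abs_le.1 h2).2]
    · rw [le_div_iff₀ (hΔx k)]
      linarith [(abs_le.1 h3).2]
  have hZt := abs_floor_mul_sub_le (hΔt k) ht
  have hZx := abs_floor_mul_sub_le (hΔx k) hx
  set n₀ := ⌊t / Δt k⌋₊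
  set i₀ := ⌊x / Δx k⌋₊
  obtain ⟨⟨β, n, i⟩, ⟨hβ, hn, hi⟩, hmax⟩ := hfin.exists_maximalFor
    (fun p : ι × ℕ × ℕ => V k p.1 p.2.1 p.2.2 -
      ((p.2.1 * Δt k - t) ^ 2 + (p.2.2 * Δx k - x) ^ 2)) _
    ⟨(γ₀, n₀, i₀), hγ₀, hZt.trans htk.2.1.le, hZx.trans hxk.2.1.le⟩
  have hmax' : ∀ γ ∈ A, ∀ m j : ℕ, |m * Δt k - t| ≤ r → |j * Δx k - x| ≤ r →
        V k γ m j - ((m * Δt k - t) ^ 2 + (j * Δx k - x) ^ 2) ≤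
          V k β n i - ((n * Δt k - t) ^ 2 + (i * Δx k - x) ^ 2) := by
    intro γ hγ m j hm hj
    by_contra hlt
    exact hlt (hmax (j := (γ, m, j)) ⟨hγ, hm, hj⟩ (not_le.1 hlt).le)
  simp only at hβ hn hi
  have h1 := hmax' γ₀ hγ₀ n₀ i₀ (hZt.trans htk.2.1.le) (hZx.trans hxk.2.1.le)
  have h2 := (abs_le.1 (hVk γ₀ hγ₀ n₀ i₀ (hZt.trans htk.2.1.le) (hZx.trans hxk.2.1.le))).1
  have h3 := hη' _ _ (hZt.trans_lt htk.1) (hZx.trans_lt hxk.1)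
    (mul_nonneg i₀.cast_nonneg (hΔx k).le)
  have h4 := (abs_le.1 (hVk β hβ n i hn hi)).2
  have h5 := hg β hβ _ _ hn hi (mul_nonneg i.cast_nonneg (hΔx k).le)
  have h6 : (n₀ * Δt k - t) ^ 2 ≤ (ρ / 4) ^ 2 := by
    rw [← sq_abs]
    exact pow_le_pow_left₀ (abs_nonneg _) (hZt.trans htk.2.2.le) 2
  have h7 : (i₀ * Δx k - x) ^ 2 ≤ (ρ / 4) ^ 2 := by
    rw [← sq_abs]
    exact pow_le_pow_left₀ (abs_nonneg _) (hZx.trans hxk.2.2.le) 2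
  have hρ2 : 0 < ρ ^ 2 := by positivity
  refine ⟨β, hβ, n, i, abs_lt_of_sq_lt_sq ?_ hρ.le, abs_lt_of_sq_lt_sq ?_ hρ.le, hmax'⟩
  · nlinarith [sq_nonneg (i * Δx k - x)]
  · nlinarith [sq_nonneg (n * Δt k - t)]

theorem Continuous.exists_forall_pos {F : ℝ × ℝ × ℝ → ℝ} (hF : Continuous F) {a b : ℝ}
    (h : 0 < F (a, b, b)) :
    ∃ ε > 0, ∀ d d₁ d₂, |d - a| ≤ ε → |d₁ - b| ≤ ε → |d₂ - b| ≤ ε → 0 < F (d, d₁, d₂) := by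
  obtain ⟨ε, hε, hsub⟩ := Metric.isOpen_iff.1 (isOpen_lt continuous_const hF) (a, b, b) h
  refine ⟨ε / 2, half_pos hε, fun d d₁ d₂ h1 h2 h3 => hsub ?_⟩
  simp only [Metric.mem_ball, Prod.dist_eq, Real.dist_eq, max_lt_iff]
  exact ⟨by linarith, by linarith, by linarith⟩

end DiscreteMax

section Viscosity

variable {N : ℕ} {H : Fin N → ℝ → ℝ} {p₀ : Fin N → ℝ} {Δx Δt : ℕ → ℝ}
  {U : ℕ → Fin N → ℕ → ℕ → ℝ} {u : Fin N → ℝ → ℝ → ℝ}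

theorem eventually_abs_sub_test_le
    (hconv : ∀ T' R δ : ℝ, 0 < δ → ∀ᶠ k in atTop, ∀ (α : Fin N) (n i : ℕ),
      n * Δt k ≤ T' → i * Δx k ≤ R → |u α (n * Δt k) (i * Δx k) - U k α n i| ≤ δ)
    (t x r : ℝ) {δ : ℝ} (hδ : 0 < δ) :
    ∀ᶠ k in atTop, ∀ (α : Fin N) (n i : ℕ), |n * Δt k - t| ≤ r → |i * Δx k - x| ≤ r →
      |u α (n * Δt k) (i * Δx k) - U k α n i| ≤ δ := by
  filter_upwards [hconv (t + r) (x + r) δ hδ] with k hk α n i hn hi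
  exact hk α n i (by linarith [(abs_le.1 hn).2]) (by linarith [(abs_le.1 hi).2])

/-- The half-relaxed subsolution property on a single branch, up to and including the junction. -/
theorem subsolution_of_tendsto (hA1 : ∀ α, A1cond (H α) (p₀ α))
    (hΔx : ∀ k, 0 < Δx k) (hΔt : ∀ k, 0 < Δt k)
    (hΔx0 : Tendsto Δx atTop (nhds 0)) (hΔt0 : Tendsto Δt atTop (nhds 0))
    (hU : ∀ k, SchemeNS H p₀ (Δx k) (Δt k) (U k))
    (hS : ∀ k, ∃ l, SlopeBound H p₀ (Δx k) (Δt k) (U k) l)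
    (hconv : ∀ T' R δ : ℝ, 0 < δ → ∀ᶠ k in atTop, ∀ (α : Fin N) (n i : ℕ),
      n * Δt k ≤ T' → i * Δx k ≤ R → |u α (n * Δt k) (i * Δx k) - U k α n i| ≤ δ)
    (α : Fin N) (hu : Continuous fun q : ℝ × ℝ => u α q.1 q.2)
    {φ : ℝ → ℝ → ℝ} {t x r a b : ℝ} (ht : 0 < t) (hx : 0 ≤ x) (hr : 0 < r)
    (hφ : StrictDiff φ t x a b)
    (hle : ∀ s y, |s - t| ≤ r → |y - x| ≤ r → 0 ≤ y → u α s y ≤ φ s y)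
    (heq : u α t x = φ t x) :
    a + Hm (H α) (p₀ α) b ≤ 0 ∧ (0 < x → a + Hp (H α) (p₀ α) b ≤ 0) := by
  have hφ' : StrictDiff (fun s y => φ s y + 1 * ((s - t) ^ 2 + (y - x) ^ 2)) t x a b := by
    simpa only [add_zero] using hφ.add (strictDiff_sq 1 t x)
  set f : ℝ → ℝ → ℝ := fun s y => φ s y + 1 * ((s - t) ^ 2 + (y - x) ^ 2) with hf
  have hmax := fun {ρ : ℝ} (hρ : 0 < ρ) => exists_discrete_max {α}
    (fun γ s y => u γ s y - φ s y) (fun k γ n i => U k γ n i - φ (n * Δt k) (i * Δx k))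
    hΔx hΔt hΔx0 hΔt0 ht.le hx hr (Finset.mem_singleton_self α)
    (fun γ hγ s y hs hy h0 => by
      rw [Finset.mem_singleton] at hγ
      subst hγ
      exact sub_nonpos.2 (hle s y hs hy h0))
    (fun δ hδ => by
      obtain ⟨η, hη, h1⟩ := hφ.exists_dist_le (half_pos hδ)
      obtain ⟨η', hη', h2⟩ := Metric.continuous_iff.1 hu (t, x) (δ / 2) (half_pos hδ)
      refine ⟨min η η', lt_min hη hη', fun s y hs hy h0 => ?_⟩
      rw [lt_min_iff] at hs hy
      have h3 := (abs_le.1 (h1 s y hs.1 hy.1 hx h0)).2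
      have h4 := h2 (s, y) (by
        rw [Prod.dist_eq, max_lt_iff]
        exact ⟨hs.2, hy.2⟩)
      rw [Real.dist_eq] at h4
      have h5 := (abs_lt.1 h4).1
      simp only at h5
      linarith)
    (fun δ hδ => by
      filter_upwards [eventually_abs_sub_test_le hconv t x r hδ] with k hk γ _ n i hn hi
      have := hk γ n i hn hi
      rw [abs_sub_comm] at this
      rwa [sub_sub_sub_cancel_right]) hρ
  have key : ∀ ρ > 0, ∃ k, ∃ n i : ℕ, |n * Δt k - t| < ρ ∧ |(n + 1 : ℕ) * Δt k - t| < ρ ∧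
      |i * Δx k - x| < ρ ∧ |(i + 1 : ℕ) * Δx k - x| < ρ ∧
      (f ((n + 1 : ℕ) * Δt k) (i * Δx k) - f (n * Δt k) (i * Δx k)) / Δt k +
        min (Hm (H α) (p₀ α) ((f (n * Δt k) ((i + 1 : ℕ) * Δx k) -
            f (n * Δt k) (i * Δx k)) / Δx k))
          (Hm (H α) (p₀ α) ((f ((n + 1 : ℕ) * Δt k) ((i + 1 : ℕ) * Δx k) -
            f ((n + 1 : ℕ) * Δt k) (i * Δx k)) / Δx k)) ≤ 0 ∧
      (0 < x → ∃ j : ℕ, |j * Δx k - x| < ρ ∧ |(j + 1 : ℕ) * Δx k - x| < ρ ∧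
      (f ((n + 1 : ℕ) * Δt k) ((j + 1 : ℕ) * Δx k) -
        f (n * Δt k) ((j + 1 : ℕ) * Δx k)) / Δt k +
        min (Hp (H α) (p₀ α) ((f (n * Δt k) ((j + 1 : ℕ) * Δx k) -
            f (n * Δt k) (j * Δx k)) / Δx k))
          (Hp (H α) (p₀ α) ((f ((n + 1 : ℕ) * Δt k) ((j + 1 : ℕ) * Δx k) -
            f ((n + 1 : ℕ) * Δt k) (j * Δx k)) / Δx k)) ≤ 0) := by
    intro ρ hρ
    have hx' : ∃ x' > 0, 0 < x → x' = x := by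
      rcases hx.eq_or_lt with h | h
      · exact ⟨1, one_pos, fun h' => absurd h h'.ne⟩
      · exact ⟨x, h, fun _ => rfl⟩
    obtain ⟨x', hx'0, hx'x⟩ := hx'
    have hρ' : 0 < min ρ (min r (min t x')) / 2 := by positivity
    set ρ' := min ρ (min r (min t x')) / 2 with hρ'def
    have hle1 : 2 * ρ' ≤ ρ ∧ 2 * ρ' ≤ r ∧ 2 * ρ' ≤ t ∧ 2 * ρ' ≤ x' := by
      have : 2 * ρ' = min ρ (min r (min t x')) := by rw [hρ'def]; ring
      rw [this]
      exact ⟨min_le_left _ _, (min_le_right _ _).trans (min_le_left _ _),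
        (min_le_right _ _).trans ((min_le_right _ _).trans (min_le_left _ _)),
        (min_le_right _ _).trans ((min_le_right _ _).trans (min_le_right _ _))⟩
    obtain ⟨k, ⟨β, hβ, n, i, hn, hi, hmk⟩, hxk, htk⟩ := ((hmax hρ').and
      ((hΔx0.eventually_lt_const hρ').and (hΔt0.eventually_lt_const hρ'))).exists
    rw [Finset.mem_singleton] at hβ
    subst hβ
    have hxp := hΔx k
    have htp := hΔt k
    rw [abs_lt] at hn hi
    cases n with
    | zero =>
      exfalso
      rw [Nat.cast_zero, zero_mul] at hn
      linarith
    | succ n =>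
    obtain ⟨l, hSl⟩ := hS k
    have en : ((n + 1 : ℕ) : ℝ) * Δt k = n * Δt k + Δt k := by push_cast; ring
    have ei : ((i + 1 : ℕ) : ℝ) * Δx k = i * Δx k + Δx k := by push_cast; ring
    have habs : ∀ {z w : ℝ}, -(2 * ρ') < z - w → z - w < 2 * ρ' → |z - w| < 2 * ρ' :=
      fun h1 h2 => abs_lt.2 ⟨h1, h2⟩
    have hn1 : |(n + 1 : ℕ) * Δt k - t| < 2 * ρ' := habs (by linarith) (by linarith)
    have hn0 : |n * Δt k - t| < 2 * ρ' := habs (by linarith) (by linarith)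
    have hi0 : |i * Δx k - x| < 2 * ρ' := habs (by linarith) (by linarith)
    have hi1 : |(i + 1 : ℕ) * Δx k - x| < 2 * ρ' := habs (by linarith) (by linarith)
    set c := U k β (n + 1) i - f ((n + 1 : ℕ) * Δt k) (i * Δx k) with hc
    have hcmp : ∀ m j : ℕ, |m * Δt k - t| < 2 * ρ' → |j * Δx k - x| < 2 * ρ' →
        U k β m j ≤ f (m * Δt k) (j * Δx k) + c := by
      intro m j hm hj
      have := hmk β (Finset.mem_singleton_self _) m j (by linarith) (by linarith)
      simp only [hc, hf]
      linarith
    have hceq : U k β (n + 1) i = f ((n + 1 : ℕ) * Δt k) (i * Δx k) + c := by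
      rw [hc]; ring
    refine ⟨k, n, i, by linarith, by linarith, by linarith, by linarith, ?_, fun hxpos => ?_⟩
    · have := hSl.test_above_Hm hA1 hxp htp (hU k)
        (f := fun m j => f (m * Δt k) (j * Δx k) + c) (hcmp n i hn0 hi0)
        (hcmp n (i + 1) hn0 hi1) hceq (hcmp (n + 1) (i + 1) hn1 hi1)
      simpa only [add_sub_add_right_eq_sub] using this
    · cases i with
      | zero =>
        exfalso
        rw [Nat.cast_zero, zero_mul] at hi
        linarith [hx'x hxpos]
      | succ j =>
      have ej : ((j + 1 : ℕ) : ℝ) * Δx k = j * Δx k + Δx k := by push_cast; ring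
      have hj0 : |j * Δx k - x| < 2 * ρ' := habs (by linarith) (by linarith)
      refine ⟨j, by linarith, by linarith, ?_⟩
      have := hSl.test_above_Hp hA1 hxp htp (hU k)
        (f := fun m j => f (m * Δt k) (j * Δx k) + c) (hcmp n j hn0 hj0)
        (hcmp n (j + 1) hn0 hi0) (hcmp (n + 1) j hn1 hj0) hceq
      simpa only [add_sub_add_right_eq_sub] using this
  constructor
  · by_contra hpos
    have hcont : Continuous fun q : ℝ × ℝ × ℝ =>
        q.1 + min (Hm (H α) (p₀ α) q.2.1) (Hm (H α) (p₀ α) q.2.2) :=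
      continuous_fst.add (((hA1 α).continuous_Hm.comp (continuous_fst.comp continuous_snd)).min
        ((hA1 α).continuous_Hm.comp (continuous_snd.comp continuous_snd)))
    obtain ⟨ε, hε, hF⟩ := hcont.exists_forall_pos (a := a) (b := b)
      (by simpa only [min_self] using not_le.1 hpos)
    obtain ⟨ρ, hρ, hq⟩ := hφ'.exists_quotients hε
    obtain ⟨k, n, i, hn0, hn1, hi0, hi1, hm, -⟩ := key ρ hρ
    have h1 := hq _ _ (hΔx k) (hΔt k) n i hn0 hi0
    have h2 := hq _ _ (hΔx k) (hΔt k) (n + 1) i hn1 hi0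
    exact absurd (hF _ _ _ (h1.1 hn1) (h1.2 hi1) (h2.2 hi1)) (not_lt.2 hm)
  · intro hxpos
    by_contra hpos
    have hcont : Continuous fun q : ℝ × ℝ × ℝ =>
        q.1 + min (Hp (H α) (p₀ α) q.2.1) (Hp (H α) (p₀ α) q.2.2) :=
      continuous_fst.add (((hA1 α).continuous_Hp.comp (continuous_fst.comp continuous_snd)).min
        ((hA1 α).continuous_Hp.comp (continuous_snd.comp continuous_snd)))
    obtain ⟨ε, hε, hF⟩ := hcont.exists_forall_pos (a := a) (b := b)
      (by simpa only [min_self] using not_le.1 hpos)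
    obtain ⟨ρ, hρ, hq⟩ := hφ'.exists_quotients hε
    obtain ⟨k, n, i, hn0, hn1, hi0, hi1, -, hm⟩ := key ρ hρ
    obtain ⟨j, hj0, hj1, hm⟩ := hm hxpos
    have h1 := hq _ _ (hΔx k) (hΔt k) n j hn0 hj0
    have h2 := hq _ _ (hΔx k) (hΔt k) (n + 1) j hn1 hj0
    have h3 := hq _ _ (hΔx k) (hΔt k) n (j + 1) hn0 hj1
    exact absurd (hF _ _ _ (h3.1 hn1) (h1.2 hj1) (h2.2 hj1)) (not_lt.2 hm)

/-- The relaxed supersolution property: tested on a set `A` of branches, containing all of them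
if the test point is the junction. -/
theorem supersolution_of_tendsto (hA1 : ∀ α, A1cond (H α) (p₀ α))
    (hΔx : ∀ k, 0 < Δx k) (hΔt : ∀ k, 0 < Δt k)
    (hΔx0 : Tendsto Δx atTop (nhds 0)) (hΔt0 : Tendsto Δt atTop (nhds 0))
    (hU : ∀ k, SchemeNS H p₀ (Δx k) (Δt k) (U k))
    (hS : ∀ k, ∃ l, SlopeBound H p₀ (Δx k) (Δt k) (U k) l)
    (hconv : ∀ T' R δ : ℝ, 0 < δ → ∀ᶠ k in atTop, ∀ (α : Fin N) (n i : ℕ),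
      n * Δt k ≤ T' → i * Δx k ≤ R → |u α (n * Δt k) (i * Δx k) - U k α n i| ≤ δ)
    (hu : ∀ α, Continuous fun q : ℝ × ℝ => u α q.1 q.2) (A : Finset (Fin N)) {γ₀ : Fin N}
    (hγ₀ : γ₀ ∈ A) {φ : Fin N → ℝ → ℝ → ℝ} {t x r : ℝ} {a b : Fin N → ℝ}
    (ht : 0 < t) (hx : 0 ≤ x) (hr : 0 < r)
    (hφ : ∀ β ∈ A, StrictDiff (φ β) t x (a β) (b β))
    (hle : ∀ β ∈ A, ∀ s y, |s - t| ≤ r → |y - x| ≤ r → 0 ≤ y → φ β s y ≤ u β s y)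
    (heq : u γ₀ t x = φ γ₀ t x) (hx0 : x = 0 → ∀ β, β ∈ A)
    (hφ0 : ∀ β γ s, φ β s 0 = φ γ s 0) :
    ∃ β ∈ A, 0 ≤ a β + H β (b β) := by
  by_contra! hneg
  set f : Fin N → ℝ → ℝ → ℝ :=
    fun β s y => φ β s y + (-1) * ((s - t) ^ 2 + (y - x) ^ 2) with hf
  have hφ' : ∀ β ∈ A, StrictDiff (f β) t x (a β) (b β) := fun β hβ => by
    simpa only [add_zero] using (hφ β hβ).add (strictDiff_sq (-1) t x)
  have hq : ∀ β ∈ A, ∃ ρ₀ > 0, ∀ ρ ≤ ρ₀, ∀ Δx Δt : ℝ, 0 < Δx → 0 < Δt → ∀ n i : ℕ,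
      |n * Δt - t| < ρ → |(n + 1 : ℕ) * Δt - t| < ρ → |i * Δx - x| < ρ →
      |(i + 1 : ℕ) * Δx - x| < ρ →
      (f β ((n + 1 : ℕ) * Δt) (i * Δx) - f β (n * Δt) (i * Δx)) / Δt +
        Hm (H β) (p₀ β) ((f β (n * Δt) ((i + 1 : ℕ) * Δx) - f β (n * Δt) (i * Δx)) / Δx) < 0 ∧
      (|(i + 1 + 1 : ℕ) * Δx - x| < ρ →
        (f β ((n + 1 : ℕ) * Δt) ((i + 1 : ℕ) * Δx) -
          f β (n * Δt) ((i + 1 : ℕ) * Δx)) / Δt +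
        max (Hp (H β) (p₀ β) ((f β (n * Δt) ((i + 1 : ℕ) * Δx) -
            f β (n * Δt) (i * Δx)) / Δx))
          (Hm (H β) (p₀ β) ((f β (n * Δt) ((i + 1 + 1 : ℕ) * Δx) -
            f β (n * Δt) ((i + 1 : ℕ) * Δx)) / Δx)) < 0) := by
    intro β hβ
    have hcont : Continuous fun q : ℝ × ℝ × ℝ =>
        -(q.1 + max (Hp (H β) (p₀ β) q.2.1) (Hm (H β) (p₀ β) q.2.2)) :=
      (continuous_fst.add (((hA1 β).continuous_Hp.comp (continuous_fst.comp continuous_snd)).max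
        ((hA1 β).continuous_Hm.comp (continuous_snd.comp continuous_snd)))).neg
    obtain ⟨ε, hε, hF⟩ := hcont.exists_forall_pos (a := a β) (b := b β)
      (by simpa only [(hA1 β).max_Hp_Hm, Left.neg_pos_iff] using hneg β hβ)
    obtain ⟨ρ₀, hρ₀, hq⟩ := (hφ' β hβ).exists_quotients hε
    refine ⟨ρ₀, hρ₀, fun ρ hρ dx dt hdx hdt n i hn0 hn1 hi0 hi1 => ⟨?_, fun hi2 => ?_⟩⟩
    · have h1 := hq _ _ hdx hdt n i (hn0.trans_le hρ) (hi0.trans_le hρ)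
      have h2 := hF _ _ _ (h1.1 (hn1.trans_le hρ))
        (by simpa using hε.le : |b β - b β| ≤ ε) (h1.2 (hi1.trans_le hρ))
      rw [Left.neg_pos_iff] at h2
      exact (add_le_add_right (le_max_right _ _) _).trans_lt h2
    · have h1 := hq _ _ hdx hdt n i (hn0.trans_le hρ) (hi0.trans_le hρ)
      have h2 := hq _ _ hdx hdt n (i + 1) (hn0.trans_le hρ) (hi1.trans_le hρ)
      exact Left.neg_pos_iff.1 (hF _ _ _ (h2.1 (hn1.trans_le hρ)) (h1.2 (hi1.trans_le hρ))
        (h2.2 (hi2.trans_le hρ)))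
  have hev := (Finset.eventually_all A (l := nhdsWithin (0 : ℝ) (Ioi 0))).2 fun β hβ => by
    obtain ⟨ρ₀, hρ₀, h⟩ := hq β hβ
    filter_upwards [Ioc_mem_nhdsGT hρ₀] with ρ hρ using h ρ hρ.2
  obtain ⟨ρ, hρq, hρ⟩ := (hev.and self_mem_nhdsWithin).exists
  have hx' : ∃ x' > 0, 0 < x → x' = x := by
    rcases hx.eq_or_lt with h | h
    · exact ⟨1, one_pos, fun h' => absurd h h'.ne⟩
    · exact ⟨x, h, fun _ => rfl⟩
  obtain ⟨x', hx'0, hx'x⟩ := hx'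
  have hρ' : 0 < min ρ (min r (min t x')) / 2 := by positivity
  set ρ' := min ρ (min r (min t x')) / 2 with hρ'def
  have hle1 : 2 * ρ' ≤ ρ ∧ 2 * ρ' ≤ r ∧ 2 * ρ' ≤ t ∧ 2 * ρ' ≤ x' := by
    have : 2 * ρ' = min ρ (min r (min t x')) := by rw [hρ'def]; ring
    rw [this]
    exact ⟨min_le_left _ _, (min_le_right _ _).trans (min_le_left _ _),
      (min_le_right _ _).trans ((min_le_right _ _).trans (min_le_left _ _)),
      (min_le_right _ _).trans ((min_le_right _ _).trans (min_le_right _ _))⟩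
  have hmax := exists_discrete_max A
    (fun γ s y => φ γ s y - u γ s y) (fun k γ n i => φ γ (n * Δt k) (i * Δx k) - U k γ n i)
    hΔx hΔt hΔx0 hΔt0 ht.le hx hr hγ₀
    (fun γ hγ s y hs hy h0 => sub_nonpos.2 (hle γ hγ s y hs hy h0))
    (fun δ hδ => by
      obtain ⟨η, hη, h1⟩ := (hφ γ₀ hγ₀).exists_dist_le (half_pos hδ)
      obtain ⟨η', hη', h2⟩ := Metric.continuous_iff.1 (hu γ₀) (t, x) (δ / 2) (half_pos hδ)
      refine ⟨min η η', lt_min hη hη', fun s y hs hy h0 => ?_⟩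
      rw [lt_min_iff] at hs hy
      have h3 := (abs_le.1 (h1 s y hs.1 hy.1 hx h0)).1
      have h4 := h2 (s, y) (by
        rw [Prod.dist_eq, max_lt_iff]
        exact ⟨hs.2, hy.2⟩)
      rw [Real.dist_eq] at h4
      have h5 := (abs_lt.1 h4).2
      simp only at h5
      linarith)
    (fun δ hδ => by
      filter_upwards [eventually_abs_sub_test_le hconv t x r hδ] with k hk γ _ n i hn hi
      have := hk γ n i hn hi
      rwa [sub_sub_sub_cancel_left]) hρ'
  obtain ⟨k, ⟨β, hβ, n, i, hn, hi, hmk⟩, hxk, htk⟩ := (hmax.and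
    ((hΔx0.eventually_lt_const hρ').and (hΔt0.eventually_lt_const hρ'))).exists
  have hxp := hΔx k
  have htp := hΔt k
  rw [abs_lt] at hn hi
  cases n with
  | zero =>
    rw [Nat.cast_zero, zero_mul] at hn
    linarith
  | succ n =>
  obtain ⟨l, hSl⟩ := hS k
  have en : ((n + 1 : ℕ) : ℝ) * Δt k = n * Δt k + Δt k := by push_cast; ring
  have ei : ((i + 1 : ℕ) : ℝ) * Δx k = i * Δx k + Δx k := by push_cast; ring
  have habs : ∀ {z w : ℝ}, -(2 * ρ') < z - w → z - w < 2 * ρ' → |z - w| < 2 * ρ' :=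
    fun h1 h2 => abs_lt.2 ⟨h1, h2⟩
  have hn1 : |(n + 1 : ℕ) * Δt k - t| < 2 * ρ' := habs (by linarith) (by linarith)
  have hn0 : |n * Δt k - t| < 2 * ρ' := habs (by linarith) (by linarith)
  have hi0 : |i * Δx k - x| < 2 * ρ' := habs (by linarith) (by linarith)
  have hi1 : |(i + 1 : ℕ) * Δx k - x| < 2 * ρ' := habs (by linarith) (by linarith)
  set c := U k β (n + 1) i - f β ((n + 1 : ℕ) * Δt k) (i * Δx k) with hc
  have hcmp : ∀ γ ∈ A, ∀ m j : ℕ, |m * Δt k - t| < 2 * ρ' → |j * Δx k - x| < 2 * ρ' →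
      f γ (m * Δt k) (j * Δx k) + c ≤ U k γ m j := by
    intro γ hγ m j hm hj
    have := hmk γ hγ m j (by linarith) (by linarith)
    simp only [hc, hf]
    linarith
  have hceq : f β ((n + 1 : ℕ) * Δt k) (i * Δx k) + c = U k β (n + 1) i := by
    rw [hc]; ring
  cases i with
  | zero =>
    have hxz : x = 0 := by
      by_contra hne
      have hxpos := lt_of_le_of_ne hx (Ne.symm hne)
      rw [Nat.cast_zero, zero_mul] at hi
      linarith [hx'x hxpos]
    have hall := hx0 hxz
    have hceq' : ∀ γ, f γ ((n + 1 : ℕ) * Δt k) ((0 : ℕ) * Δx k) + c = U k γ (n + 1) 0 := by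
      intro γ
      rw [(hU k).eq_at_zero γ β, ← hceq]
      simp only [hf, Nat.cast_zero, zero_mul, hφ0 γ β]
    obtain ⟨γ, hγ⟩ := hSl.test_below_zero hA1 hxp htp (hU k)
      (f := fun γ m j => f γ (m * Δt k) (j * Δx k) + c)
      (fun γ => hcmp γ (hall γ) n 0 hn0 hi0) (fun γ => hcmp γ (hall γ) n 1 hn0 hi1) hceq' β
    simp only [add_sub_add_right_eq_sub] at hγ
    exact absurd (hρq γ (hall γ) _ _ hxp htp n 0 (by linarith) (by linarith) (by linarith)
      (by linarith)).1 (not_lt.2 hγ)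
  | succ j =>
    have ej : ((j + 1 : ℕ) : ℝ) * Δx k = j * Δx k + Δx k := by push_cast; ring
    have hj0 : |j * Δx k - x| < 2 * ρ' := habs (by linarith) (by linarith)
    have := hSl.test_below_succ hA1 hxp htp (hU k)
      (f := fun m j => f β (m * Δt k) (j * Δx k) + c) (hcmp β hβ n j hn0 hj0)
      (hcmp β hβ n (j + 1) hn0 hi0) (hcmp β hβ n (j + 1 + 1) hn0 hi1) hceq
    simp only [add_sub_add_right_eq_sub] at this
    exact absurd ((hρq β hβ _ _ hxp htp n j (by linarith) (by linarith) (by linarith)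
      (by linarith)).2 (by linarith)) (not_lt.2 this)

end Viscosity

section Compactness

theorem abs_sub_le_mul_abs_sub {f : ℕ → ℝ} {c : ℝ} (h : ∀ n, |f (n + 1) - f n| ≤ c) (m n : ℕ) :
    |f m - f n| ≤ c * |(m : ℝ) - n| := by
  have key : ∀ m d : ℕ, |f (m + d) - f m| ≤ c * d := by
    intro m d
    induction d with
    | zero => simp
    | succ d ih =>
      have := abs_add_le (f (m + (d + 1)) - f (m + d)) (f (m + d) - f m)
      rw [sub_add_sub_cancel] at this
      have := h (m + d)
      rw [← add_assoc] at *
      push_cast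
      linarith
  rcases le_total m n with hmn | hmn <;> obtain ⟨d, rfl⟩ := Nat.exists_eq_add_of_le hmn
  · rw [abs_sub_comm, abs_sub_comm (m : ℝ)]
    simpa using key m d
  · simpa using key n d

/-- A grid function with bounded difference quotients extends to a Lipschitz function. -/
theorem exists_lipschitz_extension {N : ℕ} {V : Fin N → ℕ → ℕ → ℝ} {dx dt : ℝ} {K : NNReal}
    (hdx : 0 < dx) (hdt : 0 < dt)
    (ht : ∀ α n i, |V α (n + 1) i - V α n i| ≤ K * dt)
    (hx : ∀ α n i, |V α n (i + 1) - V α n i| ≤ K * dx) :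
    ∃ f : C(ℝ × ℝ, Fin N → ℝ), LipschitzWith (2 * K) f ∧
      ∀ α (n i : ℕ), f (n * dt, i * dx) α = V α n i := by
  have hfl : ∀ (d : ℝ) (n : ℕ), 0 < d → ⌊(n * d) / d⌋₊ = n := fun d n hd => by
    rw [mul_div_cancel_right₀ _ hd.ne', Nat.floor_natCast]
  have hlip : LipschitzOnWith (2 * K)
      (fun (q : ℝ × ℝ) (α : Fin N) => V α ⌊q.1 / dt⌋₊ ⌊q.2 / dx⌋₊)
      (range fun p : ℕ × ℕ => ((p.1 * dt, p.2 * dx) : ℝ × ℝ)) := by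
    refine LipschitzOnWith.of_dist_le_mul ?_
    rintro _ ⟨⟨n, i⟩, rfl⟩ _ ⟨⟨m, j⟩, rfl⟩
    refine (dist_pi_le_iff (by positivity)).2 fun α => ?_
    simp only [hfl _ _ hdt, hfl _ _ hdx, Real.dist_eq, Prod.dist_eq, NNReal.coe_mul,
      NNReal.coe_ofNat]
    have h1 := abs_sub_le_mul_abs_sub (f := fun n => V α n i) (fun n => ht α n i) n m
    have h2 := abs_sub_le_mul_abs_sub (f := fun i => V α m i) (fun i => hx α m i) i j
    have h3 := abs_sub_le (V α n i) (V α m i) (V α m j)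
    rw [← sub_mul, ← sub_mul, abs_mul, abs_mul, abs_of_pos hdt, abs_of_pos hdx]
    have h4 := mul_le_mul_of_nonneg_left
      (le_max_left (|(n : ℝ) - m| * dt) (|(i : ℝ) - j| * dx)) K.2
    have h5 := mul_le_mul_of_nonneg_left
      (le_max_right (|(n : ℝ) - m| * dt) (|(i : ℝ) - j| * dx)) K.2
    simp only [NNReal.val_eq_coe] at h4 h5
    linarith
  obtain ⟨g, hg, hgeq⟩ := hlip.extend_pi
  refine ⟨⟨g, hg.continuous⟩, hg, fun α n i => ?_⟩
  have := congrFun (hgeq ⟨(n, i), rfl⟩) α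
  simp only [hfl _ _ hdt, hfl _ _ hdx] at this
  exact this.symm

theorem exists_tendsto_subseq_of_lipschitz {N : ℕ} {K : NNReal} {c : Fin N → ℝ}
    (f : ℕ → C(ℝ × ℝ, Fin N → ℝ)) (hf : ∀ k, LipschitzWith K (f k)) (hc : ∀ k, f k 0 = c) :
    ∃ g : C(ℝ × ℝ, Fin N → ℝ), LipschitzWith K g ∧
      ∃ ψ : ℕ → ℕ, StrictMono ψ ∧ Tendsto (f ∘ ψ) atTop (nhds g) := by
  let S : Set C(ℝ × ℝ, Fin N → ℝ) := {g | LipschitzWith K g ∧ g 0 = c}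
  have himage : ContinuousMap.toFun '' S =
      {g : ℝ × ℝ → Fin N → ℝ | LipschitzWith K g ∧ g 0 = c} := by
    ext g
    constructor
    · rintro ⟨h, hh, rfl⟩
      exact hh
    · intro hg
      exact ⟨⟨g, hg.1.continuous⟩, hg, rfl⟩
  have hclosed : IsClosed {g : ℝ × ℝ → Fin N → ℝ | LipschitzWith K g ∧ g 0 = c} :=
    (isClosed_setOfPred_lipschitzWith K).inter
      (isClosed_singleton.preimage (continuous_apply (0 : ℝ × ℝ)) : IsClosed _)
  have hS1 : IsCompact (ContinuousMap.toFun '' S) := by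
    rw [himage]
    refine (isCompact_univ_pi fun q : ℝ × ℝ =>
      isCompact_closedBall c (K * dist q 0)).of_isClosed_subset hclosed ?_
    intro g hg q _
    have := hg.1.dist_le_mul q 0
    rwa [hg.2] at this
  have hS2 : Equicontinuous ((↑) : S → (ℝ × ℝ) → Fin N → ℝ) :=
    (LipschitzWith.uniformEquicontinuous _ K fun g => g.2.1).equicontinuous
  obtain ⟨g, hg, ψ, hψ, hlim⟩ :=
    (ArzelaAscoli.isCompact_of_equicontinuous S hS1 hS2).tendsto_subseq (x := f)
      fun k => ⟨hf k, hc k⟩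
  exact ⟨g, hg.1, ψ, hψ, hlim⟩

end Compactness

section Bounds

variable {N : ℕ} {H : Fin N → ℝ → ℝ} {p₀ : Fin N → ℝ}

theorem exists_slope_bound_of_level (hA1 : ∀ α, A1cond (H α) (p₀ α)) (M : ℝ) :
    ∃ P : ℝ, ∀ α p, H α p ≤ M → |p| ≤ P := by
  have h : ∀ α, ∃ P : ℝ, ∀ p, H α p ≤ M → |p| ≤ P := by
    intro α
    have h1 := (hA1 α).2.1.eventually (eventually_gt_atTop M)
    obtain ⟨t, ht, hts⟩ := mem_cocompact.1 h1
    obtain ⟨P, hP⟩ := ht.isBounded.exists_norm_le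
    refine ⟨P, fun p hp => hP p ?_⟩
    by_contra hpt
    exact absurd hp (not_le.2 (hts hpt))
  choose P hP using h
  obtain ⟨Q, hQ⟩ := (finite_range P).bddAbove
  exact ⟨Q, fun α p hp => (hP α p hp).trans (hQ ⟨α, rfl⟩)⟩

theorem exists_flux_bound (hA1 : ∀ α, A1cond (H α) (p₀ α)) (C : ℝ) :
    ∃ M : ℝ, ∀ α p, |p| ≤ C → H α p ≤ M := by
  have h : ∀ α, ∃ M : ℝ, ∀ p, |p| ≤ C → H α p ≤ M := by
    intro α
    obtain ⟨M, hM⟩ := (isCompact_closedBall (0 : ℝ) C).bddAbove_image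
      (hA1 α).1.continuous.continuousOn
    refine ⟨M, fun p hp => hM ⟨p, ?_, rfl⟩⟩
    simpa using hp
  choose P hP using h
  obtain ⟨Q, hQ⟩ := (finite_range P).bddAbove
  exact ⟨Q, fun α p hp => (hP α p hp).trans (hQ ⟨α, rfl⟩)⟩

/-- Under (A0), (A1) and (CFL′), solutions of the scheme have difference quotients bounded
independently of the mesh, and their slopes stay in an invariant region. -/
theorem exists_uniform_lipschitz (hN : 1 ≤ N) (hA1 : ∀ α, A1cond (H α) (p₀ α))
    {u₀ : Fin N → ℝ → ℝ} (hA0 : A0cond u₀) :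
    ∃ K : NNReal, ∀ (Δx Δt : ℝ) (U : Fin N → ℕ → ℕ → ℝ), 0 < Δx → 0 < Δt →
      SchemeNS H p₀ Δx Δt U → (∀ α (i : ℕ), U α 0 i = u₀ α (i * Δx)) →
      CFLprime H p₀ Δx Δt U →
      (∃ l, SlopeBound H p₀ Δx Δt U l) ∧
      (∀ α n i, |U α (n + 1) i - U α n i| ≤ K * Δt) ∧
      (∀ α n i, |U α n (i + 1) - U α n i| ≤ K * Δx) := by
  choose C hC using hA0.1
  obtain ⟨D, hD⟩ := (finite_range fun α => (C α : ℝ)).bddAbove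
  obtain ⟨M, hM⟩ := exists_flux_bound hA1 D
  obtain ⟨P, hP⟩ := exists_slope_bound_of_level hA1 M
  obtain ⟨Q, hQ⟩ := (finite_range fun α => -H α (p₀ α)).bddAbove
  refine ⟨(max (max P M) Q).toNNReal, fun Δx Δt U hΔx hΔt hU hinit hCFL => ?_⟩
  have hK := Real.le_coe_toNNReal (max (max P M) Q)
  set K : ℝ := ((max (max P M) Q).toNNReal : ℝ)
  have hPK : P ≤ K := ((le_max_left _ _).trans (le_max_left _ _)).trans hK
  have hMK : M ≤ K := ((le_max_right _ _).trans (le_max_left _ _)).trans hK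
  have hQK : Q ≤ K := (le_max_right _ _).trans hK
  have h0 : ∀ α i, |(U α 0 (i + 1) - U α 0 i) / Δx| ≤ D := by
    intro α i
    rw [abs_div, abs_of_pos hΔx, div_le_iff₀ hΔx, hinit, hinit]
    have h1 := (hC α).dist_le_mul (((i + 1 : ℕ) : ℝ) * Δx) (mem_Ici.2 (by positivity))
      ((i : ℝ) * Δx) (mem_Ici.2 (by positivity))
    rw [Real.dist_eq, Real.dist_eq, ← sub_mul] at h1
    have h2 : (((i + 1 : ℕ) : ℝ) - i) * Δx = Δx := by push_cast; ring
    rw [h2, abs_of_pos hΔx] at h1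
    exact h1.trans (mul_le_mul_of_nonneg_right (hD ⟨α, rfl⟩) hΔx.le)
  have hmax : ∀ α p, Hm (H α) (p₀ α) p ≤ H α p ∧ Hp (H α) (p₀ α) p ≤ H α p := fun α p => by
    rw [← (hA1 α).max_Hp_Hm p]
    exact ⟨le_max_right _ _, le_max_left _ _⟩
  obtain ⟨l, hlM, hl⟩ := hU.exists_slopeBound hN hA1 hΔx hΔt
    (fun α i => (hmax α _).1.trans (hM α _ (h0 α i)))
    (fun α i => (hmax α _).2.trans (hM α _ (h0 α i))) hCFL
  refine ⟨⟨l, hl⟩, fun α n i => ?_, fun α n i => ?_⟩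
  · have h1 := (hU n).sub_le hΔt (hl.hm n) (hl.hp n) α i
    have h2 := (hU n).le_sub_Hm hΔt α i
    have h3 := (hA1 α).min_le_Hm ((U α n (i + 1) - U α n i) / Δx)
    have h4 : -H α (p₀ α) ≤ K := (hQ ⟨α, rfl⟩).trans hQK
    have h5 := mul_le_mul_of_nonneg_left (hlM.trans hMK) hΔt.le
    have h6 := mul_le_mul_of_nonneg_left (neg_le_neg h3 |>.trans h4) hΔt.le
    rw [abs_le]
    constructor <;> linarith
  · have h1 := hP α ((U α n (i + 1) - U α n i) / Δx) (by
      rw [← (hA1 α).max_Hp_Hm]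
      exact (max_le (hl.hp n α i) (hl.hm n α i)).trans hlM)
    rw [abs_div, abs_of_pos hΔx, div_le_iff₀ hΔx] at h1
    exact h1.trans (mul_le_mul_of_nonneg_right hPK hΔx.le)

end Bounds

section Limit

theorem tendsto_floor_mul {d : ℕ → ℝ} (hd : ∀ k, 0 < d k) (hd0 : Tendsto d atTop (nhds 0))
    {t : ℝ} (ht : 0 ≤ t) :
    Tendsto (fun k => (⌊t / d k⌋₊ : ℝ) * d k) atTop (nhds t) := by
  rw [tendsto_iff_dist_tendsto_zero]
  exact squeeze_zero (fun _ => dist_nonneg)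
    (fun k => by rw [Real.dist_eq]; exact abs_floor_mul_sub_le (hd k) ht) hd0

variable {N : ℕ} {Δx Δt : ℕ → ℝ} {U : ℕ → Fin N → ℕ → ℕ → ℝ}

theorem tendsto_floor_of_conv {u : Fin N → ℝ → ℝ → ℝ}
    (hΔx : ∀ k, 0 < Δx k) (hΔt : ∀ k, 0 < Δt k)
    (hΔx0 : Tendsto Δx atTop (nhds 0)) (hΔt0 : Tendsto Δt atTop (nhds 0))
    (hconv : ∀ T' R δ : ℝ, 0 < δ → ∀ᶠ k in atTop, ∀ (α : Fin N) (n i : ℕ),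
      n * Δt k ≤ T' → i * Δx k ≤ R → |u α (n * Δt k) (i * Δx k) - U k α n i| ≤ δ)
    (α : Fin N) (hu : Continuous fun q : ℝ × ℝ => u α q.1 q.2) {t x : ℝ}
    (ht : 0 ≤ t) (hx : 0 ≤ x) :
    Tendsto (fun k => U k α ⌊t / Δt k⌋₊ ⌊x / Δx k⌋₊) atTop (nhds (u α t x)) := by
  have h1 : Tendsto (fun k => u α (⌊t / Δt k⌋₊ * Δt k) (⌊x / Δx k⌋₊ * Δx k)) atTop
      (nhds (u α t x)) :=
    (hu.tendsto (t, x)).comp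
      ((tendsto_floor_mul hΔt hΔt0 ht).prodMk_nhds (tendsto_floor_mul hΔx hΔx0 hx))
  have h2 : Tendsto (fun k => u α (⌊t / Δt k⌋₊ * Δt k) (⌊x / Δx k⌋₊ * Δx k) -
      U k α ⌊t / Δt k⌋₊ ⌊x / Δx k⌋₊) atTop (nhds 0) := by
    rw [Metric.tendsto_nhds]
    intro ε hε
    filter_upwards [hconv t x (ε / 2) (half_pos hε)] with k hk
    rw [Real.dist_eq, sub_zero]
    have h3 := Nat.floor_le (div_nonneg ht (hΔt k).le)
    have h4 := Nat.floor_le (div_nonneg hx (hΔx k).le)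
    rw [le_div_iff₀ (hΔt k)] at h3
    rw [le_div_iff₀ (hΔx k)] at h4
    exact (hk α _ _ h3 h4).trans_lt (half_lt_self hε)
  simpa using h1.sub h2

/-- Compactness of grid functions with uniformly bounded difference quotients. -/
theorem exists_limit {K : NNReal} {u₀ : Fin N → ℝ → ℝ} (hu₀ : ∀ α, ContinuousOn (u₀ α) (Ici 0))
    (hΔx : ∀ k, 0 < Δx k) (hΔt : ∀ k, 0 < Δt k)
    (hΔx0 : Tendsto Δx atTop (nhds 0)) (hΔt0 : Tendsto Δt atTop (nhds 0))
    (hinit : ∀ k (α : Fin N) (i : ℕ), U k α 0 i = u₀ α (i * Δx k))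
    (hjunction : ∀ k α β n, U k α n 0 = U k β n 0)
    (ht : ∀ k α n i, |U k α (n + 1) i - U k α n i| ≤ K * Δt k)
    (hx : ∀ k α n i, |U k α n (i + 1) - U k α n i| ≤ K * Δx k) :
    ∃ ψ : ℕ → ℕ, StrictMono ψ ∧ ∃ u : Fin N → ℝ → ℝ → ℝ,
      (∀ α, Continuous fun q : ℝ × ℝ => u α q.1 q.2) ∧ (∀ α β t, u α t 0 = u β t 0) ∧
      (∀ α x, 0 ≤ x → u α 0 x = u₀ α x) ∧
      ∀ T' R δ : ℝ, 0 < δ → ∀ᶠ k in atTop, ∀ (α : Fin N) (n i : ℕ),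
        n * Δt (ψ k) ≤ T' → i * Δx (ψ k) ≤ R →
          |u α (n * Δt (ψ k)) (i * Δx (ψ k)) - U (ψ k) α n i| ≤ δ := by
  choose f hf hfU using fun k => exists_lipschitz_extension (hΔx k) (hΔt k) (ht k) (hx k)
  obtain ⟨g, -, ψ, hψ, hlim⟩ := exists_tendsto_subseq_of_lipschitz (c := fun α => u₀ α 0) f hf
    fun k => by
      funext α
      simpa [hinit, Prod.mk_zero_zero] using hfU k α 0 0
  have hcont : ∀ α, Continuous fun q : ℝ × ℝ => g (max q.1 0, q.2) α := fun α =>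
    (continuous_apply α).comp (g.continuous.comp (by fun_prop))
  have hconv : ∀ T' R δ : ℝ, 0 < δ → ∀ᶠ k in atTop, ∀ (α : Fin N) (n i : ℕ),
      n * Δt (ψ k) ≤ T' → i * Δx (ψ k) ≤ R →
        |g (max (n * Δt (ψ k)) 0, i * Δx (ψ k)) α - U (ψ k) α n i| ≤ δ := by
    intro T' R δ hδ
    have h1 := ContinuousMap.tendsto_iff_forall_isCompact_tendstoUniformlyOn.1 hlim
      (Icc 0 T' ×ˢ Icc 0 R) (isCompact_Icc.prod isCompact_Icc)
    filter_upwards [Metric.tendstoUniformlyOn_iff.1 h1 δ hδ] with k hk α n i hn hi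
    have hn0 : 0 ≤ n * Δt (ψ k) := mul_nonneg n.cast_nonneg (hΔt _).le
    have hi0 : 0 ≤ i * Δx (ψ k) := mul_nonneg i.cast_nonneg (hΔx _).le
    have h2 := (dist_le_pi_dist _ _ α).trans
      (hk (n * Δt (ψ k), i * Δx (ψ k)) ⟨⟨hn0, hn⟩, ⟨hi0, hi⟩⟩).le
    rwa [Function.comp_apply, hfU, Real.dist_eq, ← max_eq_left hn0] at h2
  have hfloor : ∀ α {t x : ℝ}, 0 ≤ t → 0 ≤ x →
      Tendsto (fun k => U (ψ k) α ⌊t / Δt (ψ k)⌋₊ ⌊x / Δx (ψ k)⌋₊) atTop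
        (nhds (g (max t 0, x) α)) := fun α {t x} =>
    tendsto_floor_of_conv (u := fun α t x => g (max t 0, x) α) (U := fun k => U (ψ k))
      (fun k => hΔx (ψ k)) (fun k => hΔt (ψ k)) (hΔx0.comp hψ.tendsto_atTop)
      (hΔt0.comp hψ.tendsto_atTop) hconv α (hcont α)
  refine ⟨ψ, hψ, fun α t x => g (max t 0, x) α, hcont, fun α β t => ?_, fun α x hx => ?_, hconv⟩
  · have h1 := hfloor α (le_max_right t 0) le_rfl
    have h2 := hfloor β (le_max_right t 0) le_rfl
    simp only [zero_div, Nat.floor_zero, max_eq_left (le_max_right t 0)] at h1 h2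
    refine tendsto_nhds_unique h1 (h2.congr fun k => hjunction _ _ _ _)
  · have h1 := hfloor α le_rfl hx
    simp only [zero_div, Nat.floor_zero, hinit] at h1
    refine tendsto_nhds_unique h1 ?_
    refine (hu₀ α x hx).tendsto.comp (tendsto_nhdsWithin_iff.2
      ⟨tendsto_floor_mul (fun k => hΔx (ψ k)) (hΔx0.comp hψ.tendsto_atTop) hx,
        Eventually.of_forall fun k => mem_Ici.2 (mul_nonneg (Nat.cast_nonneg _) (hΔx _).le)⟩)

end Limit

section Solution

variable {N : ℕ} {H : Fin N → ℝ → ℝ} {p₀ : Fin N → ℝ} {Δx Δt : ℕ → ℝ}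
  {U : ℕ → Fin N → ℕ → ℕ → ℝ} {u : Fin N → ℝ → ℝ → ℝ} {T : ℝ}

theorem exists_pos_forall_mem_Ioo {t : ℝ} (ht : t ∈ Ioo 0 T) :
    ∃ r > 0, ∀ s, |s - t| ≤ r → s ∈ Ioo 0 T := by
  refine ⟨min t (T - t) / 2, half_pos (lt_min ht.1 (sub_pos.2 ht.2)), fun s hs => ?_⟩
  have := abs_le.1 hs
  have := min_le_left t (T - t)
  have := min_le_right t (T - t)
  have := ht.1
  have := ht.2
  constructor <;> linarith

theorem isViscSubSol_of_tendsto (hA1 : ∀ α, A1cond (H α) (p₀ α))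
    (hΔx : ∀ k, 0 < Δx k) (hΔt : ∀ k, 0 < Δt k)
    (hΔx0 : Tendsto Δx atTop (nhds 0)) (hΔt0 : Tendsto Δt atTop (nhds 0))
    (hU : ∀ k, SchemeNS H p₀ (Δx k) (Δt k) (U k))
    (hS : ∀ k, ∃ l, SlopeBound H p₀ (Δx k) (Δt k) (U k) l)
    (hconv : ∀ T' R δ : ℝ, 0 < δ → ∀ᶠ k in atTop, ∀ (α : Fin N) (n i : ℕ),
      n * Δt k ≤ T' → i * Δx k ≤ R → |u α (n * Δt k) (i * Δx k) - U k α n i| ≤ δ)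
    (hu : ∀ α, Continuous fun q : ℝ × ℝ => u α q.1 q.2) (hu0 : ∀ α β t, u α t 0 = u β t 0) :
    IsViscSubSol T H p₀ u := by
  refine ⟨fun α => (hu α).upperSemicontinuous.upperSemicontinuousOn _, hu0,
    fun φ hφ hφ0 hle => ⟨fun α t x ht hx heq => ?_, fun t ht heq α => ?_⟩⟩
  · obtain ⟨r, hr, hrt⟩ := exists_pos_forall_mem_Ioo ht
    obtain ⟨h1, h2⟩ := subsolution_of_tendsto hA1 hΔx hΔt hΔx0 hΔt0 hU hS hconv α (hu α) ht.1
      hx.le hr ((hφ α).strictDiff ht hx.le) (fun s y hs _ hy => hle α s y (hrt s hs) hy) heq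
    rw [← (hA1 α).max_Hp_Hm, ← max_add_add_left]
    exact max_le (h2 hx) h1
  · obtain ⟨r, hr, hrt⟩ := exists_pos_forall_mem_Ioo ht
    have : Nonempty (Fin N) := ⟨α⟩
    rw [← le_neg_iff_add_nonpos_left]
    refine csSup_le (range_nonempty _) ?_
    rintro _ ⟨β, rfl⟩
    have h1 := (subsolution_of_tendsto hA1 hΔx hΔt hΔx0 hΔt0 hU hS hconv β (hu β) ht.1
      le_rfl hr ((hφ β).strictDiff ht le_rfl) (fun s y hs _ hy => hle β s y (hrt s hs) hy)
      (heq β)).1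
    rw [funext (hφ0 β α)] at h1
    linarith

theorem isViscSuperSol_of_tendsto (hA1 : ∀ α, A1cond (H α) (p₀ α))
    (hΔx : ∀ k, 0 < Δx k) (hΔt : ∀ k, 0 < Δt k)
    (hΔx0 : Tendsto Δx atTop (nhds 0)) (hΔt0 : Tendsto Δt atTop (nhds 0))
    (hU : ∀ k, SchemeNS H p₀ (Δx k) (Δt k) (U k))
    (hS : ∀ k, ∃ l, SlopeBound H p₀ (Δx k) (Δt k) (U k) l)
    (hconv : ∀ T' R δ : ℝ, 0 < δ → ∀ᶠ k in atTop, ∀ (α : Fin N) (n i : ℕ),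
      n * Δt k ≤ T' → i * Δx k ≤ R → |u α (n * Δt k) (i * Δx k) - U k α n i| ≤ δ)
    (hu : ∀ α, Continuous fun q : ℝ × ℝ => u α q.1 q.2) (hu0 : ∀ α β t, u α t 0 = u β t 0) :
    IsViscSuperSol T H p₀ u := by
  refine ⟨fun α => (hu α).lowerSemicontinuous.lowerSemicontinuousOn _, hu0,
    fun φ hφ hφ0 hle => ⟨fun α t x ht hx heq => ?_, fun t ht heq α => ?_⟩⟩
  · obtain ⟨r, hr, hrt⟩ := exists_pos_forall_mem_Ioo ht
    obtain ⟨β, hβ, h⟩ := supersolution_of_tendsto hA1 hΔx hΔt hΔx0 hΔt0 hU hS hconv hu {α}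
      (Finset.mem_singleton_self α) ht.1 hx.le hr
      (fun β _ => (hφ β).strictDiff ht hx.le) (fun β _ s y hs _ hy => hle β s y (hrt s hs) hy)
      heq (fun h => absurd h hx.ne') hφ0
    rwa [Finset.mem_singleton.1 hβ] at h
  · obtain ⟨r, hr, hrt⟩ := exists_pos_forall_mem_Ioo ht
    set b : Fin N → ℝ := fun β => derivWithin (fun y => φ β t y) (Ici 0) 0 with hb
    -- lowering the slopes to at most `p₀` keeps the test function below `u`
    obtain ⟨β, -, h⟩ := supersolution_of_tendsto hA1 hΔx hΔt hΔx0 hΔt0 hU hS hconv hu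
      Finset.univ (Finset.mem_univ α)
      (φ := fun β s y => φ β s y + -max 0 (b β - p₀ β) * y) ht.1 le_rfl hr
      (fun β _ => ((hφ β).strictDiff ht le_rfl).add (strictDiff_linear _ t 0))
      (fun β _ s y hs _ hy => by
        have h1 := hle β s y (hrt s hs) hy
        have h2 := mul_nonneg (le_max_left 0 (b β - p₀ β)) hy
        linarith)
      (by simpa using heq α) (fun _ β => Finset.mem_univ β)
      (fun β γ s => by simpa using hφ0 β γ s)
    have hmin : derivWithin (fun y => φ β t y) (Ici 0) 0 + -max 0 (b β - p₀ β) =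
        min (b β) (p₀ β) := by
      rcases le_total (b β) (p₀ β) with h3 | h3
      · rw [max_eq_left (sub_nonpos.2 h3), min_eq_left h3, hb]
        simp
      · rw [max_eq_right (sub_nonneg.2 h3), min_eq_right h3, hb]
        ring
    rw [hmin, ← Hm_eq_min (H β) (p₀ β) (b β), funext (hφ0 β α), add_zero] at h
    exact h.trans (add_le_add_right (le_csSup
      (finite_range fun γ => Hm (H γ) (p₀ γ) (b γ)).bddAbove ⟨β, rfl⟩) _)

end Solution

/-- **Convergence of the numerical solution up to a subsequence** (Theorem 2.5).
Assume (A0)-(A1) and let `T > 0`. Let `ε_k = (Δt_k, Δx_k) → 0` be mesh parameters, each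
satisfying the CFL condition (CFL′), and let `U k` be the corresponding numerical
solutions of (NS) with initial condition `U^{α,0}_i = u₀^α(iΔx_k)`. Then there exist a
subsequence and a viscosity solution `u` of (HJ)-(CI) on `[0,T) × J` such that, along
this subsequence, the numerical solutions converge to `u` uniformly on every compact
subset of `[0,T) × J` (i.e. uniformly on the grid points with `nΔt ≤ T' < T` and
`iΔx ≤ R`). -/
theorem convergence_up_to_subsequence {N : ℕ} (hN : 1 ≤ N)
    (H : Fin N → ℝ → ℝ) (p₀ : Fin N → ℝ)
    (hA1 : ∀ α, A1cond (H α) (p₀ α))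
    (u₀ : Fin N → ℝ → ℝ) (hA0 : A0cond u₀)
    (T : ℝ) (hT : 0 < T)
    (Δx Δt : ℕ → ℝ)
    (hΔx : ∀ k, 0 < Δx k) (hΔt : ∀ k, 0 < Δt k)
    (hΔx0 : Tendsto Δx atTop (nhds 0)) (hΔt0 : Tendsto Δt atTop (nhds 0))
    (U : ℕ → Fin N → ℕ → ℕ → ℝ)
    (hU : ∀ k, SchemeNS H p₀ (Δx k) (Δt k) (U k))
    (hinit : ∀ k (α : Fin N) (i : ℕ), U k α 0 i = u₀ α (i * Δx k))
    (hCFL : ∀ k, CFLprime H p₀ (Δx k) (Δt k) (U k)) :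
    ∃ ψ : ℕ → ℕ, StrictMono ψ ∧
      ∃ u : Fin N → ℝ → ℝ → ℝ, IsViscSolCI T H p₀ u₀ u ∧
        ∀ T' R δ : ℝ, T' < T → 0 < δ →
          ∃ K : ℕ, ∀ k, K ≤ k → ∀ (α : Fin N) (n i : ℕ),
            (n : ℝ) * Δt (ψ k) ≤ T' → (i : ℝ) * Δx (ψ k) ≤ R →
            |u α ((n : ℝ) * Δt (ψ k)) ((i : ℝ) * Δx (ψ k)) - U (ψ k) α n i| ≤ δ := by
  obtain ⟨K, hK⟩ := exists_uniform_lipschitz hN hA1 hA0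
  have hb := fun k => hK _ _ _ (hΔx k) (hΔt k) (hU k) (hinit k) (hCFL k)
  obtain ⟨ψ, hψ, u, hu, hu0, hui, hconv⟩ := exists_limit
    (fun α => (hA0.1 α).choose_spec.continuousOn) hΔx hΔt hΔx0 hΔt0 hinit
    (fun k => (hU k).eq_at_zero) (fun k => (hb k).2.1) (fun k => (hb k).2.2)
  have hx0 := hΔx0.comp hψ.tendsto_atTop
  have ht0 := hΔt0.comp hψ.tendsto_atTop
  refine ⟨ψ, hψ, u, ⟨⟨?_, fun α x hx => (hui α x hx).le⟩, ?_, fun α x hx => (hui α x hx).ge⟩,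
    fun T' R δ _ hδ => eventually_atTop.1 (hconv T' R δ hδ)⟩
  · exact isViscSubSol_of_tendsto hA1 (fun k => hΔx (ψ k)) (fun k => hΔt (ψ k)) hx0 ht0
      (fun k => hU (ψ k)) (fun k => (hb (ψ k)).1) hconv hu hu0
  · exact isViscSuperSol_of_tendsto hA1 (fun k => hΔx (ψ k)) (fun k => hΔt (ψ k)) hx0 ht0
      (fun k => hU (ψ k)) (fun k => (hb (ψ k)).1) hconv hu hu0
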